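/- arXiv:1606.06231 — 2 statements merged into one kernel-verified Lean document; each statement's English description precedes it below -/
import Mathlib

section
/- Suppose N > 1, s < -1 and 1 ≤ p < ∞. If u ∈ D'(ℝ^N) and ∇u ∈ (L^p_s)^N, then there is a unique constant c_u ∈ ℝ such that u - c_u ∈ L^p_{s+1}, and there is a constant C = C(s,p) > 0 independent of u such that ||u - c_u||_{L^p_{s+1}} ≤ C ||\,|∇u|\,||_{L^p_s}. -/
open MeasureTheory Metric Filter Topology ENNReal

noncomputable section

/-- Euclidean space `ℝ^N`. -/
abbrev Euc (N : ℕ) := EuclideanSpace ℝ (Fin N)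

/-- Iterated classical partial derivative along a list of coordinate directions. -/
def pderivList {N : ℕ} : List (Fin N) → (Euc N → ℝ) → Euc N → ℝ
  | [], φ => φ
  | i :: l, φ => pderivList l fun x => fderiv ℝ φ x (EuclideanSpace.single i 1)

/-- `g` is the weak (distributional) partial derivative of `u` of order given by the
list `l` of coordinate directions, i.e. `g = ∂_{l₁} ⋯ ∂_{l_r} u` in `D'(ℝ^N)`. -/
def IsWeakDerivList {N : ℕ} (l : List (Fin N)) (u g : Euc N → ℝ) : Prop :=
  LocallyIntegrable u volume ∧ LocallyIntegrable g volume ∧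
    ∀ φ : Euc N → ℝ, ContDiff ℝ (⊤ : ℕ∞) φ → HasCompactSupport φ →
      ∫ x, u x * pderivList l φ x = (-1 : ℝ) ^ l.length * ∫ x, g x * φ x

/-- `g` is the weak partial derivative `∂ᵢ u`. -/
def IsWeakPartialDeriv {N : ℕ} (i : Fin N) (u g : Euc N → ℝ) : Prop :=
  IsWeakDerivList [i] u g

/-- The weight `(1+|x|)^{-s-N/q}` of the space `L^q_s` (with `N/∞ := 0`). -/
def wt (N : ℕ) (s : ℝ) (q : ℝ≥0∞) (x : Euc N) : ℝ :=
  (1 + ‖x‖) ^ (-s - (N : ℝ) / q.toReal)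

/-- Membership in the weighted space `L^q_s`. -/
def MemLs (N : ℕ) (s : ℝ) (q : ℝ≥0∞) (u : Euc N → ℝ) : Prop :=
  MemLp (fun x => wt N s q x * u x) q volume

/-- The norm of the weighted space `L^q_s`. -/
def LsNorm (N : ℕ) (s : ℝ) (q : ℝ≥0∞) (u : Euc N → ℝ) : ℝ :=
  (eLpNorm (fun x => wt N s q x * u x) q volume).toReal

/-- Membership in the exponentially weighted space `L^q_{exp,s}`. -/
def MemLexp (N : ℕ) (s : ℝ) (q : ℝ≥0∞) (u : Euc N → ℝ) : Prop :=
  MemLp (fun x => Real.exp (-(s * ‖x‖)) * u x) q volume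

/-- The norm of the exponentially weighted space `L^q_{exp,s}`. -/
def LexpNorm (N : ℕ) (s : ℝ) (q : ℝ≥0∞) (u : Euc N → ℝ) : ℝ :=
  (eLpNorm (fun x => Real.exp (-(s * ‖x‖)) * u x) q volume).toReal

/-- The pointwise Euclidean (Frobenius) norm `|∇^k u|` of the `k`-th gradient, whose
components `g m` are indexed by the `k`-tuples `m` of coordinate directions. -/
def gradNormK {N k : ℕ} (g : (Fin k → Fin N) → Euc N → ℝ) (x : Euc N) : ℝ :=
  Real.sqrt (∑ m : Fin k → Fin N, g m x ^ 2)

/-- The pointwise Euclidean norm `|∇u|` of a first-order gradient. -/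
def gradNorm1 {N : ℕ} (g : Fin N → Euc N → ℝ) (x : Euc N) : ℝ :=
  Real.sqrt (∑ i, g i x ^ 2)

/-- The interval `I_{j,p}` of admissible exponents `q`. -/
def Ijp (N j : ℕ) (p : ℝ) : Set ℝ≥0∞ :=
  if p = (N : ℝ) / (j : ℝ) ∧ 1 < N then Set.Ico (ENNReal.ofReal p) ⊤
  else if p < (N : ℝ) / (j : ℝ) then
    Set.Icc (ENNReal.ofReal p) (ENNReal.ofReal ((N : ℝ) * p / ((N : ℝ) - (j : ℝ) * p)))
  else Set.Icc (ENNReal.ofReal p) ⊤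

/-- The average of `u` on the ball `B_ρ`. -/
def ballAvg {N : ℕ} (ρ : ℝ) (u : Euc N → ℝ) : ℝ :=
  (volume (ball (0 : Euc N) ρ)).toReal⁻¹ * ∫ y in ball (0 : Euc N) ρ, u y

/-- The radial symmetrization `u_S(x) = (Nω_N)⁻¹ ∫_{S^{N-1}} u(|x|σ) dσ`. -/
def radialSymmetrization {N : ℕ} (u : Euc N → ℝ) (x : Euc N) : ℝ :=
  ((N : ℝ) * (volume (ball (0 : Euc N) 1)).toReal)⁻¹ *
    ∫ σ : sphere (0 : Euc N) 1, u (‖x‖ • (σ : Euc N)) ∂((volume : Measure (Euc N)).toSphere)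

/-- `u` is radially symmetric: `u x` only depends on `|x|`. -/
def RadSymm {N : ℕ} (u : Euc N → ℝ) : Prop :=
  ∀ x y : Euc N, ‖x‖ = ‖y‖ → u x = u y

/-- Evaluation of a polynomial on `ℝ^N` at a point. -/
def polyEval {N : ℕ} (π : MvPolynomial (Fin N) ℝ) (x : Euc N) : ℝ :=
  MvPolynomial.eval (fun i => x i) π


lemma pow_lintegral_le {α : Type*} [MeasurableSpace α] (μ : Measure α) {f : α → ℝ≥0∞}
    (hf : AEMeasurable f μ) {p : ℝ} (hp : 1 ≤ p) :
    (∫⁻ x, f x ∂μ) ^ p ≤ μ Set.univ ^ (p - 1) * ∫⁻ x, f x ^ p ∂μ := by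
  rcases hp.eq_or_lt with h | h
  · subst h; simp
  have hc : p.HolderConjugate (Real.conjExponent p) := Real.HolderConjugate.conjExponent h
  have := ENNReal.lintegral_mul_le_Lp_mul_Lq μ hc hf (aemeasurable_const (b := (1 : ℝ≥0∞)))
  simp only [Pi.mul_apply, mul_one, ENNReal.one_rpow, lintegral_const, one_mul] at this
  have hp0 : 0 < p := by linarith
  calc (∫⁻ x, f x ∂μ) ^ p ≤ ((∫⁻ x, f x ^ p ∂μ) ^ (1 / p)
        * (μ Set.univ) ^ (1 / Real.conjExponent p)) ^ p := ENNReal.rpow_le_rpow this hp0.le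
    _ = _ := by
      rw [ENNReal.mul_rpow_of_nonneg _ _ hp0.le, ← ENNReal.rpow_mul, ← ENNReal.rpow_mul, mul_comm]
      congr 1
      · congr 1
        simp only [Real.conjExponent]; field_simp
      · rw [one_div, inv_mul_cancel₀ hp0.ne', ENNReal.rpow_one]

lemma pow_lintegral_mul_le {α : Type*} [MeasurableSpace α] (μ : Measure α) {ρ f : α → ℝ≥0∞}
    (hρ : Measurable ρ) (hf : AEMeasurable f μ) {p : ℝ} (hp : 1 ≤ p) :
    (∫⁻ x, ρ x * f x ∂μ) ^ p ≤ (∫⁻ x, ρ x ∂μ) ^ (p - 1) * ∫⁻ x, ρ x * f x ^ p ∂μ := by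
  have h1 := pow_lintegral_le (μ.withDensity ρ) (f := f)
    (hf.mono_ac (withDensity_absolutelyContinuous _ _)) hp
  rw [lintegral_withDensity_eq_lintegral_mul₀ hρ.aemeasurable hf,
    lintegral_withDensity_eq_lintegral_mul₀ hρ.aemeasurable (hf.pow_const p),
    withDensity_apply _ MeasurableSet.univ, Measure.restrict_univ] at h1
  exact h1

/-- The weight `(1+|x|)^γ` as an extended nonnegative function. -/
def Wt {N : ℕ} (γ : ℝ) (x : Euc N) : ℝ≥0∞ := ENNReal.ofReal ((1 + ‖x‖) ^ γ)

lemma measurable_Wt {N : ℕ} (γ : ℝ) : Measurable (Wt (N := N) γ) := by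
  unfold Wt; fun_prop

lemma lintegral_dil {N : ℕ} {f : Euc N → ℝ≥0∞} (hf : Measurable f) {t : ℝ} (ht : 0 < t) :
    ∫⁻ x, f (t • x) = ENNReal.ofReal (t ^ (-(N : ℝ))) * ∫⁻ x, f x := by
  have h := Measure.map_addHaar_smul (volume : Measure (Euc N)) ht.ne'
  have h2 : ∫⁻ x, f (t • x) = ∫⁻ x, f x ∂(Measure.map (t • ·) (volume : Measure (Euc N))) :=
    (lintegral_map hf (by fun_prop)).symm
  rw [h2, h, lintegral_smul_measure]
  simp only [finrank_euclideanSpace, Fintype.card_fin, smul_eq_mul]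
  congr 2
  rw [abs_of_pos (by positivity), Real.rpow_neg ht.le, Real.rpow_natCast]

lemma one_add_pow_le {α t r : ℝ} (ht : 1 ≤ t) (hr : 0 ≤ r) :
    (1 + r) ^ α ≤ t ^ (max (-α) 0) * (1 + t * r) ^ α := by
  have ht0 : 0 < t := by linarith
  rcases le_total 0 α with h | h
  · rw [max_eq_right (by linarith), Real.rpow_zero, one_mul]
    apply Real.rpow_le_rpow (by linarith) _ h
    nlinarith
  · rw [max_eq_left (by linarith)]
    have h1 : (1 + t * r) ≤ t * (1 + r) := by nlinarith
    have h2 := Real.rpow_le_rpow_of_nonpos (by positivity) h1 h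
    rw [Real.mul_rpow ht0.le (by positivity)] at h2
    calc (1 + r) ^ α = t ^ (-α) * (t ^ α * (1 + r) ^ α) := by
          rw [← mul_assoc, ← Real.rpow_add ht0]; simp
      _ ≤ _ := by gcongr

lemma wt_dil {N : ℕ} {α p t : ℝ} (hp : 1 ≤ p) (ht : 1 ≤ t) (x : Euc N) :
    ‖x‖ₑ ^ p * Wt α x ≤ ENNReal.ofReal (t ^ (-p + max (-α) 0)) * Wt (α + p) (t • x) := by
  have ht0 : 0 < t := by linarith
  unfold Wt
  rw [← ofReal_norm, ENNReal.ofReal_rpow_of_nonneg (norm_nonneg _) (by linarith),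
    ← ENNReal.ofReal_mul (by positivity), ← ENNReal.ofReal_mul (by positivity)]
  apply ENNReal.ofReal_le_ofReal
  rw [norm_smul, Real.norm_of_nonneg ht0.le, Real.rpow_add ht0, Real.rpow_add (by positivity)]
  have h1 := one_add_pow_le (α := α) ht (norm_nonneg x)
  have h2 : ‖x‖ ^ p ≤ t ^ (-p) * (1 + t * ‖x‖) ^ p := by
    calc ‖x‖ ^ p = t ^ (-p) * (t ^ p * ‖x‖ ^ p) := by
          rw [← mul_assoc, ← Real.rpow_add ht0]; simp
      _ = t ^ (-p) * (t * ‖x‖) ^ p := by rw [Real.mul_rpow ht0.le (norm_nonneg _)]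
      _ ≤ _ := by
        gcongr
        linarith
  calc ‖x‖ ^ p * (1 + ‖x‖) ^ α ≤ (t ^ (-p) * (1 + t * ‖x‖) ^ p)
        * (t ^ (max (-α) 0) * (1 + t * ‖x‖) ^ α) := by gcongr
    _ = _ := by ring

lemma lintegral_Ioi_rpow_ne_top {e : ℝ} (he : e < -1) :
    ∫⁻ t in Set.Ioi (1 : ℝ), ENNReal.ofReal (t ^ e) ≠ ⊤ := by
  have := (integrableOn_Ioi_rpow_of_lt he one_pos).lintegral_lt_top
  exact this.ne

lemma hardy {N : ℕ} {α p : ℝ} (hN : 0 < N) (hp : 1 ≤ p) (hα : 0 < α + N) :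
    ∃ C : ℝ≥0∞, C ≠ ⊤ ∧ ∀ G : Euc N → ℝ≥0∞, Measurable G →
      ∫⁻ x, (∫⁻ t in Set.Ioi (1 : ℝ), ‖x‖ₑ * G (t • x)) ^ p * Wt α x
        ≤ C * ∫⁻ x, G x ^ p * Wt (α + p) x := by
  have hp0 : 0 < p := by linarith
  have hN' : (0 : ℝ) < N := by exact_mod_cast hN
  set m := max (-α) 0 with hm
  set b := N - m with hb
  have hb0 : 0 < b := by
    have : m < N := max_lt (by linarith) hN'
    linarith
  set δ := b / (2 * p) with hδ
  have hδ0 : 0 < δ := by positivity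
  set e := (1 + δ) * (p - 1) - p + m - N with he
  have he1 : e < -1 := by
    have : δ * p = b / 2 := by rw [hδ]; field_simp
    nlinarith
  set M := ∫⁻ t in Set.Ioi (1 : ℝ), ENNReal.ofReal (t ^ (-1 - δ)) with hM
  have hMt : M ≠ ⊤ := lintegral_Ioi_rpow_ne_top (by linarith)
  refine ⟨M ^ (p - 1) * ∫⁻ t in Set.Ioi (1 : ℝ), ENNReal.ofReal (t ^ e),
    ENNReal.mul_ne_top (ENNReal.rpow_ne_top_of_nonneg (by linarith) hMt)
      (lintegral_Ioi_rpow_ne_top he1), fun G hG => ?_⟩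
  have hGt : Measurable (fun z : Euc N × ℝ => G (z.2 • z.1)) := hG.comp (by fun_prop)
  have step : ∀ x : Euc N, (∫⁻ t in Set.Ioi (1 : ℝ), ‖x‖ₑ * G (t • x)) ^ p * Wt α x
      ≤ M ^ (p - 1) * ∫⁻ t in Set.Ioi (1 : ℝ), ENNReal.ofReal (t ^ ((1 + δ) * (p - 1))) *
        (‖x‖ₑ ^ p * Wt α x * G (t • x) ^ p) := by
    intro x
    have hGx : Measurable (fun t : ℝ => G (t • x)) := hG.comp (by fun_prop)
    have e1 : ∫⁻ t in Set.Ioi (1 : ℝ), ‖x‖ₑ * G (t • x) = ∫⁻ t in Set.Ioi (1 : ℝ),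
        ENNReal.ofReal (t ^ (-1 - δ)) * (ENNReal.ofReal (t ^ (1 + δ)) * (‖x‖ₑ * G (t • x))) := by
      refine setLIntegral_congr_fun measurableSet_Ioi fun t ht => ?_
      have ht0 : (0 : ℝ) < t := lt_trans one_pos ht
      rw [← mul_assoc, ← ENNReal.ofReal_mul (by positivity), ← Real.rpow_add ht0]
      simp
    rw [e1]
    have h2 := pow_lintegral_mul_le (volume.restrict (Set.Ioi (1 : ℝ)))
      (ρ := fun t => ENNReal.ofReal (t ^ (-1 - δ)))
      (f := fun t => ENNReal.ofReal (t ^ (1 + δ)) * (‖x‖ₑ * G (t • x)))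
      (by fun_prop) (by fun_prop) hp
    refine (mul_le_mul_left h2 _).trans ?_
    rw [mul_assoc]
    gcongr
    rw [← lintegral_mul_const _ (by fun_prop)]
    refine le_of_eq (setLIntegral_congr_fun measurableSet_Ioi fun t ht => ?_)
    have ht0 : (0 : ℝ) < t := lt_trans one_pos ht
    rw [ENNReal.mul_rpow_of_nonneg _ _ hp0.le, ENNReal.mul_rpow_of_nonneg _ _ hp0.le,
      ENNReal.ofReal_rpow_of_nonneg (by positivity) hp0.le, ← Real.rpow_mul ht0.le]
    have : ENNReal.ofReal (t ^ ((1 + δ) * (p - 1))) =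
        ENNReal.ofReal (t ^ (-1 - δ)) * ENNReal.ofReal (t ^ ((1 + δ) * p)) := by
      rw [← ENNReal.ofReal_mul (by positivity), ← Real.rpow_add ht0]
      congr 2; ring
    rw [this]; ring
  have hW := measurable_Wt (N := N) α
  have hW2 := measurable_Wt (N := N) (α + p)
  calc _ ≤ ∫⁻ x, M ^ (p - 1) * ∫⁻ t in Set.Ioi (1 : ℝ),
        ENNReal.ofReal (t ^ ((1 + δ) * (p - 1))) * (‖x‖ₑ ^ p * Wt α x * G (t • x) ^ p) :=
        lintegral_mono step
    _ = M ^ (p - 1) * ∫⁻ t in Set.Ioi (1 : ℝ), ∫⁻ x : Euc N,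
        ENNReal.ofReal (t ^ ((1 + δ) * (p - 1))) * (‖x‖ₑ ^ p * Wt α x * G (t • x) ^ p) := by
      rw [lintegral_const_mul' _ _ (ENNReal.rpow_ne_top_of_nonneg (by linarith) hMt),
        lintegral_lintegral_swap]
      apply Measurable.aemeasurable
      simp only [Function.uncurry_def]
      fun_prop
    _ ≤ M ^ (p - 1) * ∫⁻ t in Set.Ioi (1 : ℝ), ENNReal.ofReal (t ^ e) *
        ∫⁻ x, G x ^ p * Wt (α + p) x := by
      gcongr M ^ (p - 1) * ?_
      refine setLIntegral_mono' measurableSet_Ioi fun t ht => ?_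
      have ht1 : (1 : ℝ) ≤ t := le_of_lt ht
      have ht0 : (0 : ℝ) < t := lt_trans one_pos ht
      calc _ ≤ ∫⁻ x : Euc N, ENNReal.ofReal (t ^ ((1 + δ) * (p - 1))) *
            (ENNReal.ofReal (t ^ (-p + m)) * (G (t • x) ^ p * Wt (α + p) (t • x))) := by
            refine lintegral_mono fun x => ?_
            refine mul_le_mul_right ?_ _
            rw [mul_comm (G (t • x) ^ p), ← mul_assoc]
            exact mul_le_mul_left (wt_dil hp ht1 x) _
        _ = _ := by
          rw [lintegral_const_mul' _ _ ENNReal.ofReal_ne_top,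
            lintegral_const_mul' _ _ ENNReal.ofReal_ne_top,
            lintegral_dil (f := fun x => G x ^ p * Wt (α + p) x) (by fun_prop) ht0,
            ← mul_assoc, ← mul_assoc, ← ENNReal.ofReal_mul (by positivity),
            ← ENNReal.ofReal_mul (by positivity), ← Real.rpow_add ht0, ← Real.rpow_add ht0]
          congr 3; rw [he]; ring
    _ = _ := by
      rw [lintegral_mul_const _ (by fun_prop), mul_assoc]

lemma ray_limit {N : ℕ} {u : Euc N → ℝ} (hu : ContDiff ℝ 1 u) {x : Euc N}
    (hx : ∫⁻ t in Set.Ioi (1 : ℝ), ‖x‖ₑ * ‖fderiv ℝ u (t • x)‖ₑ ≠ ⊤) :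
    ∃ c : ℝ, Tendsto (fun n : ℕ => u ((n : ℝ) • x)) atTop (𝓝 c) ∧
      ‖u x - c‖ₑ ≤ ∫⁻ t in Set.Ioi (1 : ℝ), ‖x‖ₑ * ‖fderiv ℝ u (t • x)‖ₑ := by
  have hd : ∀ t : ℝ, HasDerivAt (fun t : ℝ => u (t • x)) (fderiv ℝ u (t • x) x) t := by
    intro t
    have h1 : HasDerivAt (fun t : ℝ => t • x) x t := by
      simpa using (hasDerivAt_id t).smul_const x
    exact ((hu.differentiable (by norm_num)) (t • x)).hasFDerivAt.comp_hasDerivAt t h1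
  have hcf : Continuous (fderiv ℝ u) := hu.continuous_fderiv (by norm_num)
  have hcont : Continuous (fun t : ℝ => fderiv ℝ u (t • x) x) := by fun_prop
  have hle : ∀ t : ℝ, ‖fderiv ℝ u (t • x) x‖ₑ ≤ ‖x‖ₑ * ‖fderiv ℝ u (t • x)‖ₑ := by
    intro t
    rw [mul_comm]
    exact ContinuousLinearMap.le_opENorm _ _
  have hintg : IntegrableOn (fun t : ℝ => fderiv ℝ u (t • x) x) (Set.Ioi 1) := by
    refine ⟨hcont.aestronglyMeasurable, ?_⟩
    exact lt_of_le_of_lt (lintegral_mono hle) (lt_top_iff_ne_top.2 hx)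
  have hlim := tendsto_limUnder_of_hasDerivAt_of_integrableOn_Ioi (fun t _ => hd t) hintg
  refine ⟨_, hlim.comp tendsto_natCast_atTop_atTop, ?_⟩
  have h2 := integral_Ioi_of_hasDerivAt_of_tendsto' (fun t _ => hd t) hintg hlim
  rw [one_smul] at h2
  rw [← enorm_neg, neg_sub, ← h2]
  exact (enorm_integral_le_lintegral_enorm _).trans (lintegral_mono hle)

lemma seg_bound {N : ℕ} {u : Euc N → ℝ} (hu : ContDiff ℝ 1 u) (x h : Euc N) {p : ℝ}
    (hp : 1 ≤ p) :
    ‖u (x + h) - u x‖ₑ ^ p ≤ ‖h‖ₑ ^ p * ∫⁻ θ in Set.Ioc (0 : ℝ) 1, ‖fderiv ℝ u (x + θ • h)‖ₑ ^ p := by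
  have hp0 : 0 < p := by linarith
  have hd : ∀ t : ℝ, HasDerivAt (fun t : ℝ => u (x + t • h)) (fderiv ℝ u (x + t • h) h) t := by
    intro t
    have h1 : HasDerivAt (fun t : ℝ => x + t • h) h t := by
      simpa using ((hasDerivAt_id t).smul_const h).const_add x
    exact ((hu.differentiable (by norm_num)) (x + t • h)).hasFDerivAt.comp_hasDerivAt t h1
  have hcf : Continuous (fderiv ℝ u) := hu.continuous_fderiv (by norm_num)
  have hcont : Continuous (fun t : ℝ => fderiv ℝ u (x + t • h) h) := by fun_prop
  have h2 := intervalIntegral.integral_eq_sub_of_hasDerivAt (a := 0) (b := 1) (fun t _ => hd t)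
    (hcont.intervalIntegrable _ _)
  simp only [one_smul, zero_smul, add_zero] at h2
  rw [← h2, intervalIntegral.integral_of_le zero_le_one]
  have h3 : ‖∫ t in Set.Ioc (0 : ℝ) 1, fderiv ℝ u (x + t • h) h‖ₑ ≤
      ‖h‖ₑ * ∫⁻ t in Set.Ioc (0 : ℝ) 1, ‖fderiv ℝ u (x + t • h)‖ₑ := by
    rw [← lintegral_const_mul _ (by fun_prop)]
    refine (enorm_integral_le_lintegral_enorm _).trans (lintegral_mono fun t => ?_)
    rw [mul_comm]
    exact ContinuousLinearMap.le_opENorm _ _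
  refine (ENNReal.rpow_le_rpow h3 hp0.le).trans ?_
  rw [ENNReal.mul_rpow_of_nonneg _ _ hp0.le]
  gcongr
  have := pow_lintegral_le (volume.restrict (Set.Ioc (0 : ℝ) 1))
    (f := fun t : ℝ => ‖fderiv ℝ u (x + t • h)‖ₑ) (by fun_prop) hp
  simpa using this

/-- On a region of size comparable to `n`, the weight is comparable to a power of `n`. -/
lemma wt_lower {N : ℕ} (β : ℝ) {m M : ℝ} (hm : 0 < m) (hmM : m ≤ M) : ∃ c : ℝ, 0 < c ∧
    ∀ (n : ℝ) (y : Euc N), 0 < n → m * n ≤ 1 + ‖y‖ → 1 + ‖y‖ ≤ M * n →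
      ENNReal.ofReal (c * n ^ β) ≤ Wt β y := by
  have hM : 0 < M := by linarith
  refine ⟨min (m ^ β) (M ^ β), by positivity, fun n y hn h1 h2 => ?_⟩
  apply ENNReal.ofReal_le_ofReal
  rcases le_total 0 β with h | h
  · calc _ ≤ m ^ β * n ^ β := by gcongr; exact min_le_left _ _
      _ = (m * n) ^ β := by rw [Real.mul_rpow hm.le hn.le]
      _ ≤ _ := by gcongr
  · calc _ ≤ M ^ β * n ^ β := by gcongr; exact min_le_right _ _
      _ = (M * n) ^ β := by rw [Real.mul_rpow hM.le hn.le]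
      _ ≤ _ := Real.rpow_le_rpow_of_nonpos (by positivity) h2 h

lemma trans_decay {N : ℕ} {α p : ℝ} (hp : 1 ≤ p) (hα : 0 < α + N) {u : Euc N → ℝ}
    (hu : ContDiff ℝ 1 u) (hK : ∫⁻ x, ‖fderiv ℝ u x‖ₑ ^ p * Wt (α + p) x ≠ ⊤)
    {x0 h : Euc N} (hx0 : x0 ≠ 0) (hh : ‖h‖ < ‖x0‖ / 4) :
    Tendsto (fun n : ℕ => ∫⁻ x in ball x0 (‖x0‖ / 4),
      ‖u ((n : ℝ) • (x + h)) - u ((n : ℝ) • x)‖ₑ ^ p) atTop (𝓝 0) := by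
  have hp0 : 0 < p := by linarith
  have hx0' : 0 < ‖x0‖ := norm_pos_iff.2 hx0
  set K := ∫⁻ x, ‖fderiv ℝ u x‖ₑ ^ p * Wt (α + p) x with hKd
  have hcf : Continuous (fderiv ℝ u) := hu.continuous_fderiv (by norm_num)
  obtain ⟨c, hc, hcW⟩ := wt_lower (N := N) (α + p) (m := ‖x0‖ / 2) (M := 1 + 2 * ‖x0‖)
    (by positivity) (by linarith)
  have hW2 := measurable_Wt (N := N) (α + p)
  -- the integral on the larger ball
  have key : ∀ n : ℕ, 1 ≤ n → ∫⁻ z in ball x0 (‖x0‖ / 2), ‖fderiv ℝ u ((n : ℝ) • z)‖ₑ ^ p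
      ≤ ENNReal.ofReal (c⁻¹ * (n : ℝ) ^ (-(α + p) - N)) * K := by
    intro n hn
    have hn1 : (1 : ℝ) ≤ n := by exact_mod_cast hn
    have hn0 : (0 : ℝ) < n := by linarith
    calc ∫⁻ z in ball x0 (‖x0‖ / 2), ‖fderiv ℝ u ((n : ℝ) • z)‖ₑ ^ p
        ≤ ∫⁻ z in ball x0 (‖x0‖ / 2), ENNReal.ofReal (c⁻¹ * (n : ℝ) ^ (-(α + p))) *
          (‖fderiv ℝ u ((n : ℝ) • z)‖ₑ ^ p * Wt (α + p) ((n : ℝ) • z)) := by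
          refine setLIntegral_mono' measurableSet_ball fun z hz => ?_
          rw [mem_ball, dist_eq_norm] at hz
          have hz1 : ‖x0‖ / 2 ≤ ‖z‖ := by
            have := norm_sub_norm_le x0 z
            rw [norm_sub_rev] at this; linarith
          have hz2 : ‖z‖ ≤ 2 * ‖x0‖ := by
            have := norm_sub_norm_le z x0
            linarith
          have := hcW n ((n : ℝ) • z) hn0 (by
            rw [norm_smul, Real.norm_of_nonneg hn0.le]; nlinarith) (by
            rw [norm_smul, Real.norm_of_nonneg hn0.le]; nlinarith)
          calc ‖fderiv ℝ u ((n : ℝ) • z)‖ₑ ^ p = ENNReal.ofReal (c⁻¹ * (n : ℝ) ^ (-(α + p))) *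
              (‖fderiv ℝ u ((n : ℝ) • z)‖ₑ ^ p * ENNReal.ofReal (c * (n : ℝ) ^ (α + p))) := by
                rw [mul_comm (‖fderiv ℝ u ((n : ℝ) • z)‖ₑ ^ p), ← mul_assoc,
                  ← ENNReal.ofReal_mul (by positivity)]
                have : c⁻¹ * (n : ℝ) ^ (-(α + p)) * (c * (n : ℝ) ^ (α + p)) = 1 := by
                  rw [Real.rpow_neg hn0.le]; field_simp
                rw [this]; simp
            _ ≤ _ := by gcongr
      _ ≤ ∫⁻ z, ENNReal.ofReal (c⁻¹ * (n : ℝ) ^ (-(α + p))) *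
          (‖fderiv ℝ u ((n : ℝ) • z)‖ₑ ^ p * Wt (α + p) ((n : ℝ) • z)) :=
          setLIntegral_le_lintegral _ _
      _ = _ := by
          rw [lintegral_const_mul' _ _ ENNReal.ofReal_ne_top,
            lintegral_dil (f := fun x => ‖fderiv ℝ u x‖ₑ ^ p * Wt (α + p) x)
              (by fun_prop) hn0, ← mul_assoc, ← ENNReal.ofReal_mul (by positivity), mul_assoc,
              ← Real.rpow_add hn0]
          rfl
  have bound : ∀ n : ℕ, 1 ≤ n → ∫⁻ x in ball x0 (‖x0‖ / 4),
      ‖u ((n : ℝ) • (x + h)) - u ((n : ℝ) • x)‖ₑ ^ p ≤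
      ENNReal.ofReal ((n : ℝ) ^ (-(α + N))) * (ENNReal.ofReal (‖h‖ ^ p * c⁻¹) * K) := by
    intro n hn
    have hn1 : (1 : ℝ) ≤ n := by exact_mod_cast hn
    have hn0 : (0 : ℝ) < n := by linarith
    have hnh : ‖(n : ℝ) • h‖ₑ ^ p ≠ ⊤ := ENNReal.rpow_ne_top_of_nonneg hp0.le enorm_ne_top
    calc _ ≤ ∫⁻ x in ball x0 (‖x0‖ / 4), ‖(n : ℝ) • h‖ₑ ^ p * ∫⁻ θ in Set.Ioc (0 : ℝ) 1,
          ‖fderiv ℝ u ((n : ℝ) • x + θ • ((n : ℝ) • h))‖ₑ ^ p := by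
          refine lintegral_mono fun x => ?_
          rw [smul_add]
          exact seg_bound hu _ _ hp
      _ = ‖(n : ℝ) • h‖ₑ ^ p * ∫⁻ θ in Set.Ioc (0 : ℝ) 1, ∫⁻ x in ball x0 (‖x0‖ / 4),
          ‖fderiv ℝ u ((n : ℝ) • x + θ • ((n : ℝ) • h))‖ₑ ^ p := by
          rw [lintegral_const_mul' _ _ hnh, lintegral_lintegral_swap]
          apply Measurable.aemeasurable
          simp only [Function.uncurry_def]
          fun_prop
      _ ≤ ‖(n : ℝ) • h‖ₑ ^ p * ∫⁻ θ in Set.Ioc (0 : ℝ) 1,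
          ENNReal.ofReal (c⁻¹ * (n : ℝ) ^ (-(α + p) - N)) * K := by
          refine mul_le_mul_right (setLIntegral_mono' measurableSet_Ioc fun θ hθ => ?_) _
          refine le_trans ?_ (key n hn)
          rw [← lintegral_indicator measurableSet_ball, ← lintegral_indicator measurableSet_ball,
            ← lintegral_add_right_eq_self ((ball x0 (‖x0‖ / 2)).indicator _) (θ • h)]
          refine lintegral_mono fun x => ?_
          by_cases hx : x ∈ ball x0 (‖x0‖ / 4)
          · have hx2 : x + θ • h ∈ ball x0 (‖x0‖ / 2) := by
              rw [mem_ball, dist_eq_norm] at hx ⊢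
              have : ‖θ • h‖ ≤ ‖h‖ := by
                rw [norm_smul, Real.norm_of_nonneg hθ.1.le]
                have := hθ.2
                nlinarith [norm_nonneg h]
              calc ‖x + θ • h - x0‖ = ‖(x - x0) + θ • h‖ := by congr 1; abel
                _ ≤ ‖x - x0‖ + ‖θ • h‖ := norm_add_le _ _
                _ < _ := by linarith
            rw [Set.indicator_of_mem hx, Set.indicator_of_mem hx2, smul_add, smul_comm θ]
          · rw [Set.indicator_of_notMem hx]; exact zero_le
      _ = _ := by
          simp only [lintegral_const, MeasurableSet.univ, Measure.restrict_apply, Set.univ_inter,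
            Real.volume_Ioc, sub_zero, ENNReal.ofReal_one, mul_one]
          rw [← ofReal_norm, ENNReal.ofReal_rpow_of_nonneg (norm_nonneg _) hp0.le, ← mul_assoc,
            ← mul_assoc, ← ENNReal.ofReal_mul (by positivity), ← ENNReal.ofReal_mul (by positivity),
            norm_smul, Real.norm_of_nonneg hn0.le, Real.mul_rpow hn0.le (norm_nonneg _)]
          congr 2
          have : (n : ℝ) ^ (-(α + N)) = (n : ℝ) ^ p * (n : ℝ) ^ (-(α + p) - N) := by
            rw [← Real.rpow_add hn0]; congr 1; ring
          rw [this]; ring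
  have hlim : Tendsto (fun n : ℕ => ENNReal.ofReal ((n : ℝ) ^ (-(α + N))) *
      (ENNReal.ofReal (‖h‖ ^ p * c⁻¹) * K)) atTop (𝓝 0) := by
    have h1 : Tendsto (fun n : ℕ => ENNReal.ofReal ((n : ℝ) ^ (-(α + N)))) atTop (𝓝 0) := by
      have := (tendsto_rpow_neg_atTop hα).comp (tendsto_natCast_atTop_atTop (R := ℝ))
      simpa using ENNReal.tendsto_ofReal this
    have := ENNReal.Tendsto.mul_const (b := ENNReal.ofReal (‖h‖ ^ p * c⁻¹) * K) h1
      (Or.inr (ENNReal.mul_ne_top ENNReal.ofReal_ne_top hK))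
    simpa using this
  refine tendsto_of_tendsto_of_tendsto_of_le_of_le' tendsto_const_nhds hlim
    (Eventually.of_forall fun _ => zero_le) ?_
  filter_upwards [eventually_ge_atTop 1] with n hn using bound n hn

/-- A measurable function which is locally a.e. constant away from the origin is a.e. constant. -/
lemma ae_const_of_local {N : ℕ} (hN : 1 < N) {c : Euc N → ℝ}
    (hloc : ∀ x0 : Euc N, x0 ≠ 0 → ∃ r > 0, ∃ k : ℝ, ∀ᵐ y, y ∈ ball x0 r → c y = k) :
    ∃ k : ℝ, ∀ᵐ y, c y = k := by
  have hconn : IsPreconnected ({0}ᶜ : Set (Euc N)) := by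
    refine (isConnected_compl_singleton_of_one_lt_rank ?_ 0).isPreconnected
    rw [← Module.finrank_eq_rank]
    simp only [finrank_euclideanSpace, Fintype.card_fin]
    exact_mod_cast hN
  choose! r hr k hk using hloc
  have : Nontrivial (Euc N) := by
    have : Nonempty (Fin N) := ⟨⟨0, by omega⟩⟩
    infer_instance
  obtain ⟨e, he⟩ := exists_ne (0 : Euc N)
  have hev : ∀ x : Euc N, x ≠ 0 → ∀ y ∈ ball x (r x), y ≠ 0 → k y = k x := by
    intro x hx y hy hy0
    have hopen : IsOpen (ball x (r x) ∩ ball y (r y)) := isOpen_ball.inter isOpen_ball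
    have hpos : 0 < volume (ball x (r x) ∩ ball y (r y)) :=
      hopen.measure_pos _ ⟨y, hy, mem_ball_self (hr y hy0)⟩
    by_contra hne
    have hz : volume (ball x (r x) ∩ ball y (r y)) = 0 := by
      refine measure_mono_null (t := {z | ¬ ((z ∈ ball x (r x) → c z = k x) ∧
        (z ∈ ball y (r y) → c z = k y))}) ?_ ((hk x hx).and (hk y hy0))
      rintro z ⟨h1, h2⟩ h3
      exact hne ((h3.2 h2).symm.trans (h3.1 h1))
    exact hpos.ne' hz
  have hall : ∀ x : Euc N, x ≠ 0 → k x = k e := by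
    intro x hx
    refine @IsPreconnected.constant _ _ ℝ ⊥ (discreteTopology_bot ℝ) _ hconn k ?_ _ _ hx he
    intro y hy
    have : ∀ᶠ z in 𝓝[{0}ᶜ] y, k z = k y := by
      rw [eventually_nhdsWithin_iff]
      filter_upwards [ball_mem_nhds y (hr y hy)] with z hz hz0 using hev y hy z hz hz0
    exact (tendsto_pure.2 this).mono_right (@pure_le_nhds ℝ ⊥ _)
  refine ⟨k e, ?_⟩
  have hnull : volume ({x : Euc N | x ≠ 0 ∧ c x ≠ k e}) = 0 := by
    refine measure_null_of_locally_null _ fun x hx => ?_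
    refine ⟨ball x (r x) ∩ {x | x ≠ 0 ∧ c x ≠ k e},
      inter_mem (mem_nhdsWithin_of_mem_nhds (ball_mem_nhds x (hr x hx.1))) self_mem_nhdsWithin, ?_⟩
    refine measure_mono_null ?_ (hk x hx.1)
    rintro z ⟨h1, _, h2⟩ h3
    exact h2 ((h3 h1).trans (hall x hx.1))
  have h0 : ∀ᵐ y : Euc N, y ≠ 0 := by
    simp [ae_iff]
  filter_upwards [h0, (measure_eq_zero_iff_ae_notMem.1 hnull)] with y hy hy2
  by_contra hne
  exact hy2 ⟨hy, hne⟩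

lemma smooth_case {N : ℕ} {α p : ℝ} (hN : 1 < N) (hp : 1 ≤ p) (hα : 0 < α + N) :
    ∃ C : ℝ≥0∞, C ≠ ⊤ ∧ ∀ u : Euc N → ℝ, ContDiff ℝ 1 u →
      ∫⁻ x, ‖fderiv ℝ u x‖ₑ ^ p * Wt (α + p) x ≠ ⊤ → ∃ k : ℝ,
      ∫⁻ x, ‖u x - k‖ₑ ^ p * Wt α x ≤ C * ∫⁻ x, ‖fderiv ℝ u x‖ₑ ^ p * Wt (α + p) x := by
  have hp0 : 0 < p := by linarith
  obtain ⟨C, hC, hH⟩ := hardy (N := N) (by omega) hp hα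
  refine ⟨C, hC, fun u hu hK => ?_⟩
  have hcf : Continuous (fderiv ℝ u) := hu.continuous_fderiv (by norm_num)
  have hcu : Continuous u := hu.continuous
  have hH1 := hH (fun x => ‖fderiv ℝ u x‖ₑ) (by fun_prop)
  have hfin : ∀ᵐ x : Euc N, ∫⁻ t in Set.Ioi (1 : ℝ), ‖x‖ₑ * ‖fderiv ℝ u (t • x)‖ₑ ≠ ⊤ := by
    have hmeas : Measurable fun x : Euc N =>
        (∫⁻ t in Set.Ioi (1 : ℝ), ‖x‖ₑ * ‖fderiv ℝ u (t • x)‖ₑ) := by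
      apply Measurable.lintegral_prod_right'
        (f := fun z : Euc N × ℝ => ‖z.1‖ₑ * ‖fderiv ℝ u (z.2 • z.1)‖ₑ)
      fun_prop
    have := ae_lt_top' (((hmeas.pow_const p).mul (measurable_Wt α)).aemeasurable)
      (ne_top_of_le_ne_top (ENNReal.mul_ne_top hC hK) hH1)
    filter_upwards [this] with x hx htop
    rw [Pi.mul_apply, htop, ENNReal.top_rpow_of_pos hp0, ENNReal.top_mul] at hx
    · exact lt_irrefl _ hx
    · simp only [Wt, ne_eq, ENNReal.ofReal_eq_zero, not_le]; positivity
  set c : Euc N → ℝ := fun x => limUnder atTop (fun n : ℕ => u ((n : ℝ) • x)) with hcdef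
  have hcm : Measurable c := by
    refine (StronglyMeasurable.limUnder (l := atTop) (f := fun (n : ℕ) x => u ((n : ℝ) • x))
      fun n => ?_).measurable
    exact Continuous.stronglyMeasurable (by fun_prop)
  have hlim : ∀ᵐ x : Euc N, Tendsto (fun n : ℕ => u ((n : ℝ) • x)) atTop (𝓝 (c x)) ∧
      ‖u x - c x‖ₑ ≤ ∫⁻ t in Set.Ioi (1 : ℝ), ‖x‖ₑ * ‖fderiv ℝ u (t • x)‖ₑ := by
    filter_upwards [hfin] with x hx
    obtain ⟨l, hl, hb⟩ := ray_limit hu hx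
    have : c x = l := hl.limUnder_eq
    rw [this]; exact ⟨hl, hb⟩
  have hconst : ∃ k : ℝ, ∀ᵐ y, c y = k := by
    refine ae_const_of_local hN fun x0 hx0 => ?_
    have hx0' : 0 < ‖x0‖ := norm_pos_iff.2 hx0
    set r := ‖x0‖ / 4 with hr
    have hr0 : 0 < r := by positivity
    have htr : ∀ h : Euc N, h ∈ ball (0 : Euc N) r → ∀ᵐ x, x ∈ ball x0 r → c (x + h) = c x := by
      intro h hh
      rw [mem_ball_zero_iff] at hh
      have hdec := trans_decay hp hα hu hK hx0 hh
      have hsh : ∀ᵐ x : Euc N, Tendsto (fun n : ℕ => u ((n : ℝ) • (x + h))) atTop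
          (𝓝 (c (x + h))) :=
        (quasiMeasurePreserving_add_right volume h).ae (hlim.mono fun _ hx => hx.1)
      have hfat : ∫⁻ x in ball x0 r, ‖c (x + h) - c x‖ₑ ^ p = 0 := by
        refine le_antisymm ?_ zero_le
        calc _ ≤ ∫⁻ x in ball x0 r, liminf (fun n : ℕ =>
              ‖u ((n : ℝ) • (x + h)) - u ((n : ℝ) • x)‖ₑ ^ p) atTop := by
              refine lintegral_mono_ae (ae_restrict_of_ae ?_)
              filter_upwards [hlim, hsh] with x h1 h2
              refine le_of_eq (Tendsto.liminf_eq ?_).symm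
              exact ((h2.sub h1.1).enorm).ennrpow_const p
          _ ≤ _ := lintegral_liminf_le fun n => by fun_prop
          _ = 0 := hdec.liminf_eq
      rw [lintegral_eq_zero_iff (by fun_prop)] at hfat
      rw [Filter.EventuallyEq, ae_restrict_iff' measurableSet_ball] at hfat
      filter_upwards [hfat] with x hx hxb
      have := hx hxb
      simp only [Pi.zero_apply, ENNReal.rpow_eq_zero_iff_of_pos hp0, enorm_eq_zero,
        sub_eq_zero] at this
      exact this
    have hm : MeasurableSet {z : Euc N × Euc N | (fun h x => h ∈ ball (0 : Euc N) r →
        x ∈ ball x0 r → c (x + h) = c x) z.1 z.2} := by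
      have hset : MeasurableSet {z : Euc N × Euc N | c (z.2 + z.1) = c z.2} :=
        measurableSet_eq_fun (by fun_prop) (by fun_prop)
      have h1 : MeasurableSet {z : Euc N × Euc N | z.1 ∈ ball (0 : Euc N) r} :=
        measurable_fst measurableSet_ball
      have h2 : MeasurableSet {z : Euc N × Euc N | z.2 ∈ ball x0 r} :=
        measurable_snd measurableSet_ball
      convert! h1.compl.union (h2.compl.union hset) using 1
      ext z
      simp only [Set.mem_ofPred_eq, Set.mem_union, Set.mem_compl_iff]
      tauto
    have hae : ∀ᵐ h : Euc N, ∀ᵐ x : Euc N, h ∈ ball (0 : Euc N) r →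
        x ∈ ball x0 r → c (x + h) = c x := by
      refine Eventually.of_forall fun h => ?_
      by_cases hh : h ∈ ball (0 : Euc N) r
      · filter_upwards [htr h hh] with x hx _ using hx
      · exact Eventually.of_forall fun x h' => absurd h' hh
    rw [Measure.ae_ae_comm hm] at hae
    have hpos : 0 < volume (ball x0 (r / 2)) := measure_ball_pos _ _ (by positivity)
    obtain ⟨x, hxb, hx⟩ : ∃ x ∈ ball x0 (r / 2), ∀ᵐ h : Euc N, h ∈ ball (0 : Euc N) r →
        x ∈ ball x0 r → c (x + h) = c x := by
      by_contra hno
      refine hpos.ne' (measure_mono_null ?_ hae)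
      intro x hx hx2; exact hno ⟨x, hx, hx2⟩
    refine ⟨r / 2, by positivity, c x, ?_⟩
    have hx' := (quasiMeasurePreserving_add_right volume (-x)).ae hx
    filter_upwards [hx'] with y hy hyb
    have hxr : x ∈ ball x0 r := ball_subset_ball (by linarith) hxb
    have := hy (by
      rw [mem_ball_zero_iff, ← sub_eq_add_neg, ← dist_eq_norm]
      calc dist y x ≤ dist y x0 + dist x x0 := dist_triangle_right _ _ _
        _ < r := by rw [mem_ball] at hyb hxb; linarith) hxr
    simpa using this
  obtain ⟨k, hk⟩ := hconst
  refine ⟨k, le_trans (lintegral_mono_ae ?_) hH1⟩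
  filter_upwards [hk, hlim] with x h1 h2
  rw [h1] at h2
  gcongr
  exact h2.2

lemma opENorm_le_bound_aux {N : ℕ} (L : Euc N →L[ℝ] ℝ) {A : ℝ≥0∞}
    (h : ∀ v : Euc N, ‖L v‖ₑ ≤ A * ‖v‖ₑ) : ‖L‖ₑ ≤ A :=
  L.opENorm_le_bound h

/-- The mollification of `u`. -/
def moll {N : ℕ} (φ : ContDiffBump (0 : Euc N)) (u : Euc N → ℝ) : Euc N → ℝ :=
  MeasureTheory.convolution (φ.normed volume) u (ContinuousLinearMap.lsmul ℝ ℝ) volume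

lemma moll_contDiff {N : ℕ} (φ : ContDiffBump (0 : Euc N)) {u : Euc N → ℝ}
    (hu : LocallyIntegrable u volume) : ContDiff ℝ 1 (moll φ u) :=
  φ.hasCompactSupport_normed.contDiff_convolution_left _ (φ.contDiff_normed (n := 1)) hu

lemma moll_integrable {N : ℕ} (φ : ContDiffBump (0 : Euc N)) {u : Euc N → ℝ}
    (hu : LocallyIntegrable u volume) (x : Euc N) :
    Integrable (fun t => φ.normed volume (x - t) * u t) := by
  have h := (φ.hasCompactSupport_normed (μ := volume)).convolutionExists_left
    (ContinuousLinearMap.lsmul ℝ ℝ) φ.continuous_normed hu x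
  have := h.integrable_swap
  simpa using this

lemma moll_partial {N : ℕ} (φ : ContDiffBump (0 : Euc N)) {u g : Euc N → ℝ} {i : Fin N}
    (h : IsWeakPartialDeriv i u g) (x : Euc N) :
    fderiv ℝ (moll φ u) x (EuclideanSpace.single i 1) = ∫ t, φ.normed volume (x - t) * g t := by
  obtain ⟨hu, hg, hw⟩ := h
  set η := φ.normed (volume : Measure (Euc N)) with hη
  have hηs : ContDiff ℝ (⊤ : ℕ∞) η := φ.contDiff_normed
  have hη1 : ContDiff ℝ 1 η := φ.contDiff_normed (n := 1)
  have hηc : HasCompactSupport η := φ.hasCompactSupport_normed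
  have hd := hηc.hasFDerivAt_convolution_left (ContinuousLinearMap.lsmul ℝ ℝ) hη1 hu x
  have h1 : fderiv ℝ (moll φ u) x (EuclideanSpace.single i 1)
      = ∫ t, u t * fderiv ℝ η (x - t) (EuclideanSpace.single i 1) := by
    rw [moll, hd.fderiv, ← convolution_flip]
    have := convolution_precompR_apply (ContinuousLinearMap.lsmul ℝ ℝ : ℝ →L[ℝ] ℝ →L[ℝ] ℝ).flip
      (μ := volume) hu (hηc.fderiv ℝ)
      (hη1.continuous_fderiv (by norm_num)) x (EuclideanSpace.single i 1)
    refine this.trans ?_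
    rw [convolution_def]
    simp [mul_comm]
  have hψ : ContDiff ℝ (⊤ : ℕ∞) (fun t => η (x - t)) := hηs.comp (by fun_prop)
  have hψc : HasCompactSupport (fun t => η (x - t)) :=
    hηc.comp_homeomorph (Homeomorph.subLeft x)
  have hw1 := hw _ hψ hψc
  have hfd : ∀ t, fderiv ℝ (fun t => η (x - t)) t (EuclideanSpace.single i 1)
      = - fderiv ℝ η (x - t) (EuclideanSpace.single i 1) := by
    intro t
    have ha : HasFDerivAt (fun t : Euc N => x - t) (-(ContinuousLinearMap.id ℝ (Euc N))) t := by
      simpa using (hasFDerivAt_id t).const_sub x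
    have hb := ((hη1.differentiable (by norm_num)) (x - t)).hasFDerivAt.comp t ha
    have := hb.fderiv
    rw [show (fun t => η (x - t)) = η ∘ (fun t => x - t) from rfl, this]
    simp
  simp only [pderivList, hfd, mul_neg, integral_neg, List.length_cons, List.length_nil, zero_add,
    pow_one, neg_mul, one_mul, neg_inj] at hw1
  rw [h1, hw1]
  simp_rw [mul_comm]

lemma sum_mul_le_gradNorm {N : ℕ} (g : Fin N → Euc N → ℝ) (v t : Euc N) :
    |∑ i, v i * g i t| ≤ ‖v‖ * gradNorm1 g t := by
  rw [EuclideanSpace.norm_eq, gradNorm1]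
  simp only [Real.norm_eq_abs, sq_abs]
  rw [← Real.sqrt_mul (Finset.sum_nonneg fun i _ => sq_nonneg _)]
  exact Real.abs_le_sqrt (Finset.sum_mul_sq_le_sq_mul_sq _ _ _)

lemma moll_fderiv_le {N : ℕ} (φ : ContDiffBump (0 : Euc N)) {u : Euc N → ℝ}
    {g : Fin N → Euc N → ℝ} (h : ∀ i, IsWeakPartialDeriv i u (g i)) (x : Euc N) :
    ‖fderiv ℝ (moll φ u) x‖ₑ ≤
      ∫⁻ t, ENNReal.ofReal (φ.normed volume (x - t)) * ‖gradNorm1 g t‖ₑ := by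
  refine opENorm_le_bound_aux _ fun v => ?_
  have hv : v = ∑ i, v i • EuclideanSpace.single i (1 : ℝ) := by
    ext j; simp [Finset.sum_apply, Pi.single_apply]
  have e1 : fderiv ℝ (moll φ u) x v = ∫ t, φ.normed volume (x - t) * ∑ i, v i * g i t := by
    conv_lhs => rw [hv]
    rw [map_sum]
    simp only [map_smul, smul_eq_mul, moll_partial φ (h _) x]
    simp_rw [← integral_const_mul]
    rw [← integral_finsetSum]
    · congr 1; ext t; rw [Finset.mul_sum]; congr 1; ext i; ring
    · intro i _
      exact (moll_integrable φ (h i).2.1 x).const_mul _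
  rw [e1, mul_comm, ← lintegral_const_mul' _ _ enorm_ne_top]
  refine (enorm_integral_le_lintegral_enorm _).trans (lintegral_mono fun t => ?_)
  rw [enorm_mul, mul_left_comm, Real.enorm_eq_ofReal (φ.nonneg_normed _), ← enorm_norm v, ← enorm_mul]
  gcongr
  rw [enorm_le_iff_norm_le, Real.norm_eq_abs, norm_mul, norm_norm]
  refine (sum_mul_le_gradNorm g v t).trans ?_
  gcongr
  exact le_abs_self _

lemma wt_shift {N : ℕ} (γ : ℝ) {x t : Euc N} (h : ‖x - t‖ ≤ 1) :
    Wt γ x ≤ ENNReal.ofReal (2 ^ |γ|) * Wt γ t := by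
  unfold Wt
  rw [← ENNReal.ofReal_mul (by positivity)]
  apply ENNReal.ofReal_le_ofReal
  have h1 : 1 + ‖x‖ ≤ 2 * (1 + ‖t‖) := by
    have := norm_sub_norm_le x t
    nlinarith [norm_nonneg t]
  have h2 : 1 + ‖t‖ ≤ 2 * (1 + ‖x‖) := by
    have := norm_sub_norm_le t x
    rw [norm_sub_rev] at this
    nlinarith [norm_nonneg x]
  have hx : 0 < 1 + ‖x‖ := by positivity
  have ht : 0 < 1 + ‖t‖ := by positivity
  rcases le_total 0 γ with hg | hg
  · rw [abs_of_nonneg hg, ← Real.mul_rpow (by norm_num) ht.le]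
    exact Real.rpow_le_rpow hx.le h1 hg
  · have h3 : 2⁻¹ * (1 + ‖t‖) ≤ 1 + ‖x‖ := by linarith
    have := Real.rpow_le_rpow_of_nonpos (by positivity) h3 hg
    rwa [Real.mul_rpow (by norm_num) ht.le, Real.inv_rpow (by norm_num), ← Real.rpow_neg (by norm_num),
      ← abs_of_nonpos hg] at this

lemma moll_bound {N : ℕ} {p : ℝ} (hp : 1 ≤ p) (γ : ℝ) (φ : ContDiffBump (0 : Euc N))
    (hφ : φ.rOut ≤ 1) {u : Euc N → ℝ}
    {g : Fin N → Euc N → ℝ} (h : ∀ i, IsWeakPartialDeriv i u (g i)) :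
    ∫⁻ x, ‖fderiv ℝ (moll φ u) x‖ₑ ^ p * Wt γ x ≤
      ENNReal.ofReal (2 ^ |γ|) * ∫⁻ x, ‖gradNorm1 g x‖ₑ ^ p * Wt γ x := by
  have hp0 : 0 < p := by linarith
  set η := φ.normed (volume : Measure (Euc N)) with hη
  have hηc : Continuous η := φ.continuous_normed
  have hW := measurable_Wt (N := N) γ
  have hη1 : ∫⁻ t, ENNReal.ofReal (η t) = 1 := by
    rw [← ofReal_integral_eq_lintegral_ofReal φ.integrable_normed
      (Eventually.of_forall φ.nonneg_normed), φ.integral_normed, ENNReal.ofReal_one]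
  have hgm : AEMeasurable (fun t => ‖gradNorm1 g t‖ₑ) (volume : Measure (Euc N)) := by
    have hgi : ∀ i, AEMeasurable (g i) volume := fun i => (h i).2.1.aestronglyMeasurable.aemeasurable
    have : AEMeasurable (fun t => gradNorm1 g t) (volume : Measure (Euc N)) := by
      unfold gradNorm1
      refine Real.continuous_sqrt.measurable.comp_aemeasurable ?_
      exact Finset.aemeasurable_fun_sum _ fun i _ => (hgi i).pow_const 2
    exact this.enorm
  have step : ∀ x, ‖fderiv ℝ (moll φ u) x‖ₑ ^ p * Wt γ x ≤
      ENNReal.ofReal (2 ^ |γ|) * ∫⁻ t, ENNReal.ofReal (η (x - t)) * (‖gradNorm1 g t‖ₑ ^ p * Wt γ t) := by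
    intro x
    have h1 := pow_lintegral_mul_le volume (ρ := fun t => ENNReal.ofReal (η (x - t)))
      (f := fun t => ‖gradNorm1 g t‖ₑ) (by fun_prop) hgm hp
    have h2 : ∫⁻ t, ENNReal.ofReal (η (x - t)) = 1 := by
      rw [lintegral_sub_left_eq_self (fun t => ENNReal.ofReal (η t)) x, hη1]
    rw [h2, ENNReal.one_rpow, one_mul] at h1
    calc _ ≤ (∫⁻ t, ENNReal.ofReal (η (x - t)) * ‖gradNorm1 g t‖ₑ ^ p) * Wt γ x := by
          gcongr
          exact (ENNReal.rpow_le_rpow (moll_fderiv_le φ h x) hp0.le).trans h1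
      _ = ∫⁻ t, ENNReal.ofReal (η (x - t)) * ‖gradNorm1 g t‖ₑ ^ p * Wt γ x :=
          (lintegral_mul_const' _ _ ENNReal.ofReal_ne_top).symm
      _ ≤ ∫⁻ t, ENNReal.ofReal (2 ^ |γ|) *
          (ENNReal.ofReal (η (x - t)) * (‖gradNorm1 g t‖ₑ ^ p * Wt γ t)) := by
          refine lintegral_mono fun t => ?_
          by_cases hz : η (x - t) = 0
          · simp [hz]
          have hs : x - t ∈ Function.support η := hz
          rw [hη, φ.support_normed_eq, mem_ball_zero_iff] at hs
          calc _ ≤ ENNReal.ofReal (η (x - t)) * ‖gradNorm1 g t‖ₑ ^ p *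
                (ENNReal.ofReal (2 ^ |γ|) * Wt γ t) := by
                gcongr
                exact wt_shift γ (hs.le.trans hφ)
            _ = _ := by ring
      _ = _ := lintegral_const_mul' _ _ ENNReal.ofReal_ne_top
  calc _ ≤ _ := lintegral_mono step
    _ = ENNReal.ofReal (2 ^ |γ|) * ∫⁻ t, ∫⁻ x, ENNReal.ofReal (η (x - t)) *
          (‖gradNorm1 g t‖ₑ ^ p * Wt γ t) := by
        rw [lintegral_const_mul' _ _ ENNReal.ofReal_ne_top, lintegral_lintegral_swap]
        have hF : AEMeasurable (fun t : Euc N => ‖gradNorm1 g t‖ₑ ^ p * Wt γ t) volume :=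
          (hgm.pow_const p).mul hW.aemeasurable
        have hF2 : AEMeasurable (fun z : Euc N × Euc N => ‖gradNorm1 g z.2‖ₑ ^ p * Wt γ z.2)
          (volume.prod volume) := hF.comp_snd
        simp only [Function.uncurry_def]
        refine AEMeasurable.mul ?_ hF2
        exact Measurable.aemeasurable (by fun_prop)
    _ = _ := by
        congr 1
        refine lintegral_congr fun t => ?_
        rw [lintegral_mul_const _ (by fun_prop),
          lintegral_sub_right_eq_self (fun t => ENNReal.ofReal (η t)) t, hη1, one_mul]

lemma lintegral_Wt_eq_top {N : ℕ} {α : ℝ} (hN : 0 < N) (hα : 0 < α + N) :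
    ∫⁻ x : Euc N, Wt α x = ⊤ := by
  by_contra hI
  have hN' : (0 : ℝ) < N := by exact_mod_cast hN
  set I := ∫⁻ x : Euc N, Wt α x with hId
  set m := max (-α) 0 with hm
  have hmN : m < N := max_lt (by linarith) hN'
  have hI0 : I ≠ 0 := by
    intro h0
    rw [hId, lintegral_eq_zero_iff (measurable_Wt α)] at h0
    have hF : ∀ᵐ x : Euc N, False := by
      filter_upwards [h0] with x hx
      have : 0 < Wt α x := ENNReal.ofReal_pos.2 (by positivity)
      exact this.ne' hx
    have := (ae_iff.1 hF)
    simp only [not_false_eq_true] at this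
    exact (isOpen_univ.measure_pos (volume : Measure (Euc N)) Set.univ_nonempty).ne'
      (by simpa using this)
  have h1 : I ≤ ENNReal.ofReal (2 ^ (m - N)) * I := by
    calc I ≤ ∫⁻ x : Euc N, ENNReal.ofReal (2 ^ m) * Wt α ((2 : ℝ) • x) := by
          refine lintegral_mono fun x => ?_
          unfold Wt
          rw [← ENNReal.ofReal_mul (by positivity), norm_smul, Real.norm_of_nonneg (by norm_num)]
          exact ENNReal.ofReal_le_ofReal (one_add_pow_le (by norm_num) (norm_nonneg x))
      _ = _ := by
        rw [lintegral_const_mul' _ _ ENNReal.ofReal_ne_top,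
          lintegral_dil (measurable_Wt α) (by norm_num), ← mul_assoc,
          ← ENNReal.ofReal_mul (by positivity), ← Real.rpow_add (by norm_num)]
        rfl
  have h2 : ENNReal.ofReal (2 ^ (m - N)) < 1 := by
    rw [← ENNReal.ofReal_one, ENNReal.ofReal_lt_ofReal_iff one_pos]
    exact Real.rpow_lt_one_of_one_lt_of_neg (by norm_num) (by linarith)
  have h3 : ENNReal.ofReal (2 ^ (m - N)) * I < 1 * I := by
    rw [mul_comm, mul_comm 1]
    exact ENNReal.mul_lt_mul_right hI0 hI h2
  rw [one_mul] at h3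
  exact absurd h1 (not_le.2 h3)

lemma weak_case {N : ℕ} {α p : ℝ} (hN : 1 < N) (hp : 1 ≤ p) (hα : 0 < α + N) :
    ∃ C : ℝ≥0∞, C ≠ ⊤ ∧ ∀ (u : Euc N → ℝ) (g : Fin N → Euc N → ℝ),
      (∀ i, IsWeakPartialDeriv i u (g i)) →
      ∫⁻ x, ‖gradNorm1 g x‖ₑ ^ p * Wt (α + p) x ≠ ⊤ → ∃ k : ℝ,
      ∫⁻ x, ‖u x - k‖ₑ ^ p * Wt α x ≤ C * ∫⁻ x, ‖gradNorm1 g x‖ₑ ^ p * Wt (α + p) x := by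
  have hp0 : 0 < p := by linarith
  obtain ⟨C, hC, hS⟩ := smooth_case (α := α) hN hp hα
  refine ⟨C * ENNReal.ofReal (2 ^ |α + p|), ENNReal.mul_ne_top hC ENNReal.ofReal_ne_top,
    fun u g h hK => ?_⟩
  set K := ∫⁻ x, ‖gradNorm1 g x‖ₑ ^ p * Wt (α + p) x with hKd
  have hu : LocallyIntegrable u volume := (h ⟨0, by omega⟩).1
  set φ : ℕ → ContDiffBump (0 : Euc N) := fun n =>
    ⟨1 / (n + 1) / 2, 1 / (n + 1), by positivity, half_lt_self (by positivity)⟩ with hφd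
  have hφ1 : ∀ n, (φ n).rOut ≤ 1 := fun n => by
    simp only [hφd]
    rw [div_le_one (by positivity)]
    have : (0 : ℝ) ≤ n := by positivity
    linarith
  have hφ0 : Tendsto (fun n => (φ n).rOut) atTop (𝓝 0) := tendsto_one_div_add_atTop_nhds_zero_nat
  have hconv : ∀ᵐ x, Tendsto (fun n => moll (φ n) u x) atTop (𝓝 (u x)) :=
    ContDiffBump.ae_convolution_tendsto_right_of_locallyIntegrable (K := 2) hφ0
      (Eventually.of_forall fun n => by simp only [hφd]; linarith) hu
  have hcont : ∀ n, Continuous (moll (φ n) u) := fun n => (moll_contDiff (φ n) hu).continuous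
  have hex : ∀ n, ∃ k : ℝ, ∫⁻ x, ‖moll (φ n) u x - k‖ₑ ^ p * Wt α x ≤
      C * ENNReal.ofReal (2 ^ |α + p|) * K := by
    intro n
    have hb := moll_bound hp (α + p) (φ n) (hφ1 n) h
    obtain ⟨k, hk⟩ := hS _ (moll_contDiff (φ n) hu)
      (ne_top_of_le_ne_top (ENNReal.mul_ne_top ENNReal.ofReal_ne_top hK) hb)
    refine ⟨k, hk.trans ?_⟩
    rw [mul_assoc]
    gcongr
  choose k hk using hex
  set M := C * ENNReal.ofReal (2 ^ |α + p|) * K with hM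
  have hMt : M ≠ ⊤ := ENNReal.mul_ne_top (ENNReal.mul_ne_top hC ENNReal.ofReal_ne_top) hK
  have hW := measurable_Wt (N := N) α
  -- the constants do not escape to infinity
  have hbdd : ∃ R : ℝ, ∃ᶠ n in atTop, k n ∈ closedBall (0 : ℝ) R := by
    by_contra hno
    push Not at hno
    have htop : Tendsto (fun n => ‖k n‖) atTop atTop := by
      rw [Filter.tendsto_atTop]
      intro R
      filter_upwards [hno R] with n hn
      rw [mem_closedBall_zero_iff, not_le] at hn
      exact hn.le
    have : ∫⁻ x : Euc N, (⊤ : ℝ≥0∞) ≤ M := by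
      calc _ ≤ ∫⁻ x : Euc N, liminf (fun n => ‖moll (φ n) u x - k n‖ₑ ^ p * Wt α x) atTop := by
            refine lintegral_mono_ae ?_
            filter_upwards [hconv] with x hx
            refine le_of_eq (Tendsto.liminf_eq ?_).symm
            have h1 : Tendsto (fun n => ‖moll (φ n) u x - k n‖) atTop atTop := by
              have h2 : Tendsto (fun n => ‖k n‖ - ‖moll (φ n) u x‖) atTop atTop := by
                exact Tendsto.atTop_add htop (hx.norm.neg)
              refine tendsto_atTop_mono (fun n => ?_) h2
              rw [norm_sub_rev]
              exact norm_sub_norm_le _ _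
            have h3 : Tendsto (fun n => ‖moll (φ n) u x - k n‖ₑ) atTop (𝓝 ⊤) := by
              have := ENNReal.tendsto_ofReal_atTop.comp h1
              refine this.congr fun n => ?_
              exact ofReal_norm _
            have h4 := h3.ennrpow_const p
            rw [ENNReal.top_rpow_of_pos hp0] at h4
            have h5 := ENNReal.Tendsto.mul_const (b := Wt α x) h4 (Or.inl ENNReal.top_ne_zero)
            rwa [ENNReal.top_mul] at h5
            simp only [Wt, ne_eq, ENNReal.ofReal_eq_zero, not_le]; positivity
        _ ≤ _ := lintegral_liminf_le fun n => by
            have := hcont n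
            fun_prop
        _ ≤ M := liminf_le_of_frequently_le' (Frequently.of_forall hk)
    rw [lintegral_const, ENNReal.top_mul (isOpen_univ.measure_pos (volume : Measure (Euc N)) Set.univ_nonempty).ne'] at this
    exact hMt (top_le_iff.1 this)
  obtain ⟨R, hR⟩ := hbdd
  obtain ⟨k0, _, ψ, hψ, hkψ⟩ := tendsto_subseq_of_frequently_bounded isBounded_closedBall hR
  refine ⟨k0, ?_⟩
  calc _ ≤ ∫⁻ x : Euc N, liminf (fun n => ‖moll (φ (ψ n)) u x - k (ψ n)‖ₑ ^ p * Wt α x) atTop := by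
        refine lintegral_mono_ae ?_
        filter_upwards [hconv] with x hx
        refine le_of_eq (Tendsto.liminf_eq ?_).symm
        have h1 := (((hx.comp hψ.tendsto_atTop).sub hkψ).enorm).ennrpow_const p
        exact ENNReal.Tendsto.mul_const h1 (Or.inr ENNReal.ofReal_ne_top)
    _ ≤ _ := lintegral_liminf_le fun n => by
        have := hcont (ψ n)
        fun_prop
    _ ≤ M := liminf_le_of_frequently_le' (Frequently.of_forall fun n => hk (ψ n))


lemma continuous_wt (N : ℕ) (s : ℝ) (q : ℝ≥0∞) : Continuous (wt N s q) := by
  unfold wt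
  refine Continuous.rpow_const (by fun_prop) fun x => Or.inl ?_
  positivity

lemma eLpNorm_wt {N : ℕ} {s p : ℝ} (hp : 1 ≤ p) (f : Euc N → ℝ) :
    eLpNorm (fun x => wt N s (ENNReal.ofReal p) x * f x) (ENNReal.ofReal p) volume =
      (∫⁻ x, ‖f x‖ₑ ^ p * Wt (-s * p - N) x) ^ (1 / p) := by
  have hp0 : 0 < p := by linarith
  rw [eLpNorm_eq_lintegral_rpow_enorm_toReal (by simpa using hp0) ENNReal.ofReal_ne_top,
    ENNReal.toReal_ofReal hp0.le]
  congr 1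
  refine lintegral_congr fun x => ?_
  rw [enorm_mul, ENNReal.mul_rpow_of_nonneg _ _ hp0.le, mul_comm]
  congr 1
  have h0 : 0 < wt N s (ENNReal.ofReal p) x := by unfold wt; positivity
  rw [Real.enorm_of_nonneg h0.le, ENNReal.ofReal_rpow_of_pos h0]
  unfold wt Wt
  rw [ENNReal.toReal_ofReal hp0.le, ← Real.rpow_mul (by positivity)]
  congr 2
  field_simp

/-- Theorem 5(i). If `N > 1`, `s < -1`, `1 ≤ p < ∞` and
`∇u ∈ (L^p_s)^N`, there is a unique constant `c_u` with `u - c_u ∈ L^p_{s+1}`, and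
`‖u - c_u‖_{L^p_{s+1}} ≤ C ‖|∇u|‖_{L^p_s}` with `C = C(s,p)` independent of `u`. -/
theorem stmt_7 {N : ℕ} (hN : 1 < N) (s p : ℝ) (hs : s < -1) (hp : 1 ≤ p) :
    ∃ C : ℝ, 0 < C ∧
      ∀ (u : Euc N → ℝ) (g : Fin N → Euc N → ℝ),
        (∀ i, IsWeakPartialDeriv i u (g i)) →
        (∀ i, MemLs N s (ENNReal.ofReal p) (g i)) →
        ∃ c : ℝ,
          MemLs N (s + 1) (ENNReal.ofReal p) (fun x => u x - c) ∧
          (∀ c' : ℝ, MemLs N (s + 1) (ENNReal.ofReal p) (fun x => u x - c') → c' = c) ∧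
          LsNorm N (s + 1) (ENNReal.ofReal p) (fun x => u x - c)
            ≤ C * LsNorm N s (ENNReal.ofReal p) (gradNorm1 g) := by
  have hp0 : 0 < p := by linarith
  have hαN : 0 < (-(s + 1) * p - N) + (N : ℝ) := by nlinarith
  obtain ⟨C, hC, hw⟩ := weak_case hN hp hαN
  have hC' : C ^ (1 / p) ≠ ⊤ := ENNReal.rpow_ne_top_of_nonneg (by positivity) hC
  refine ⟨(C ^ (1 / p)).toReal + 1, by positivity, fun u g hug hg => ?_⟩
  have hexp : (-(s + 1) * p - N) + p = -s * p - (N : ℝ) := by ring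
  rw [hexp] at hw
  have hu : LocallyIntegrable u volume := (hug ⟨0, by omega⟩).1
  have hgm : ∀ i, AEStronglyMeasurable (g i) volume := fun i => (hug i).2.1.aestronglyMeasurable
  have hsum : MemLp (fun x => ∑ i, ‖wt N s (ENNReal.ofReal p) x * g i x‖)
      (ENNReal.ofReal p) volume :=
    memLp_finsetSum _ fun i _ => (hg i).norm
  have hgn : AEStronglyMeasurable (gradNorm1 g) volume := by
    unfold gradNorm1
    refine Real.continuous_sqrt.comp_aestronglyMeasurable ?_
    exact Finset.aestronglyMeasurable_fun_sum _ fun i _ => (hgm i).pow 2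
  have hG : MemLp (fun x => wt N s (ENNReal.ofReal p) x * gradNorm1 g x)
      (ENNReal.ofReal p) volume := by
    refine hsum.mono ((continuous_wt N s _).aestronglyMeasurable.mul hgn) ?_
    refine Eventually.of_forall fun x => ?_
    rw [Real.norm_of_nonneg (Finset.sum_nonneg fun i _ => norm_nonneg _)]
    simp only [norm_mul]
    rw [← Finset.mul_sum]
    refine mul_le_mul_of_nonneg_left ?_ (norm_nonneg _)
    unfold gradNorm1
    rw [Real.norm_of_nonneg (Real.sqrt_nonneg _), Real.sqrt_le_left
      (Finset.sum_nonneg fun i _ => norm_nonneg _)]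
    have := Finset.sum_sq_le_sq_sum_of_nonneg (s := Finset.univ) (f := fun i => ‖g i x‖)
      (fun i _ => norm_nonneg _)
    simpa using this
  have hGt := hG.2
  rw [eLpNorm_wt hp] at hGt
  have hK : ∫⁻ x, ‖gradNorm1 g x‖ₑ ^ p * Wt (-s * p - N) x ≠ ⊤ := by
    intro h
    rw [h, ENNReal.top_rpow_of_pos (by positivity)] at hGt
    exact lt_irrefl _ hGt
  obtain ⟨c, hc⟩ := hw u g hug hK
  have hle : eLpNorm (fun x => wt N (s + 1) (ENNReal.ofReal p) x * (u x - c))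
      (ENNReal.ofReal p) volume ≤ C ^ (1 / p) *
      eLpNorm (fun x => wt N s (ENNReal.ofReal p) x * gradNorm1 g x) (ENNReal.ofReal p) volume := by
    rw [eLpNorm_wt hp, eLpNorm_wt hp, ← ENNReal.mul_rpow_of_nonneg _ _ (by positivity)]
    exact ENNReal.rpow_le_rpow hc (by positivity)
  have hrt := ENNReal.mul_ne_top hC' hG.2.ne
  have hmem : MemLs N (s + 1) (ENNReal.ofReal p) (fun x => u x - c) := by
    refine ⟨(continuous_wt N (s + 1) _).aestronglyMeasurable.mul
      (hu.aestronglyMeasurable.sub aestronglyMeasurable_const), ?_⟩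
    exact lt_of_le_of_lt hle hrt.lt_top
  refine ⟨c, hmem, fun c' hc' => ?_, ?_⟩
  · by_contra hne
    have hd := hmem.sub hc'
    have hd' : MemLp (fun x => wt N (s + 1) (ENNReal.ofReal p) x * (c' - c))
        (ENNReal.ofReal p) volume := by
      refine hd.ae_eq (Eventually.of_forall fun x => ?_)
      simp only [Pi.sub_apply]
      ring
    have hlt := hd'.2
    rw [eLpNorm_wt hp (fun _ => c' - c), lintegral_const_mul _ (measurable_Wt _),
      lintegral_Wt_eq_top (by omega) hαN, ENNReal.mul_top, ENNReal.top_rpow_of_pos (by positivity)]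
      at hlt
    · exact lt_irrefl _ hlt
    · have : ‖c' - c‖ₑ ≠ 0 := by simpa [sub_eq_zero] using hne
      simp only [ne_eq, ENNReal.rpow_eq_zero_iff, not_or, not_and_or]
      exact ⟨Or.inl this, Or.inl (by simp)⟩
  · unfold LsNorm
    have h1 := ENNReal.toReal_mono hrt hle
    rw [ENNReal.toReal_mul] at h1
    refine h1.trans ?_
    refine mul_le_mul_of_nonneg_right ?_ ENNReal.toReal_nonneg
    linarith

end
end

section
/- Suppose N > 1, s < -1 and 1 ≤ p < ∞, and let u ∈ D'(ℝ^N) be radially symmetric with ∇u ∈ (L^p_s)^N. Then for every q ∈ I_{1,p} there is a unique constant c_u ∈ ℝ (independent of q) such that u - c_u ∈ L^q_{s+1}, and for each such q there is a constant C = C(s,p,q) > 0 independent of u such that ||u - c_u||_{L^q_{s+1}} ≤ C ||\,|∇u|\,||_{L^p_s}. Furthermore, if p > N, then lim_{|x|→∞} |x|^{-(s+1)} (u(x) - c_u) = 0. -/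
open MeasureTheory Metric Filter Topology ENNReal

noncomputable section

lemma aux_jensen {α : Type*} [MeasurableSpace α] (μ : Measure α) (p : ℝ) (hp : 1 ≤ p)
    (G ρ : α → ℝ≥0∞) (hG : Measurable G) (hρ : Measurable ρ)
    (h0 : ∀ᵐ a ∂μ, ρ a ≠ 0 ∧ ρ a ≠ ⊤) :
    (∫⁻ a, G a ∂μ) ^ p ≤ (∫⁻ a, ρ a ∂μ) ^ (p - 1) * ∫⁻ a, G a ^ p * ρ a ^ (1 - p) ∂μ := by
  have hp0 : 0 < p := by linarith
  have h1 : ∫⁻ a, G a ∂μ = ∫⁻ a, (G a ^ p * ρ a ^ (1 - p)) ^ (1 / p) * ρ a ^ (1 - 1 / p) ∂μ := by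
    apply lintegral_congr_ae
    filter_upwards [h0] with a ha
    rw [ENNReal.mul_rpow_of_nonneg _ _ (by positivity), ← ENNReal.rpow_mul, ← ENNReal.rpow_mul,
      mul_assoc, ← ENNReal.rpow_add _ _ ha.1 ha.2]
    have e1 : p * (1 / p) = 1 := by field_simp
    have e2 : (1 - p) * (1 / p) + (1 - 1 / p) = 0 := by field_simp; ring
    rw [e1, e2]; simp
  have h2 := ENNReal.lintegral_mul_norm_pow_le (μ := μ) (f := fun a => G a ^ p * ρ a ^ (1 - p))
    (g := ρ) (by fun_prop) (by fun_prop) (p := 1 / p) (q := 1 - 1 / p) (by positivity)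
    (by rw [sub_nonneg, div_le_one hp0]; exact hp) (by ring)
  rw [← h1] at h2
  calc (∫⁻ a, G a ∂μ) ^ p ≤ _ := ENNReal.rpow_le_rpow h2 hp0.le
    _ = _ := by
      rw [ENNReal.mul_rpow_of_nonneg _ _ hp0.le, ← ENNReal.rpow_mul, ← ENNReal.rpow_mul, mul_comm]
      have e1 : 1 / p * p = 1 := by field_simp
      have e2 : (1 - 1 / p) * p = p - 1 := by field_simp
      rw [e1, e2]; simp

lemma aux_lint_Ioc (a t : ℝ) (ha : 0 < a) (ht : 0 ≤ t) :
    ∫⁻ r in Set.Ioc 0 t, ENNReal.ofReal (r ^ (a - 1)) = ENNReal.ofReal (t ^ a / a) := by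
  rw [← ofReal_integral_eq_lintegral_ofReal]
  · rw [← intervalIntegral.integral_of_le ht, integral_rpow (by left; linarith)]
    simp [Real.zero_rpow ha.ne']
  · exact (intervalIntegral.intervalIntegrable_rpow' (by linarith)).1
  · filter_upwards [ae_restrict_mem measurableSet_Ioc] with r hr
    exact Real.rpow_nonneg hr.1.le _

lemma aux_lint_Ioi (α r : ℝ) (ha : 0 < α) (hr : 0 < r) :
    ∫⁻ t in Set.Ioi r, ENNReal.ofReal (t ^ (-1 - α)) = ENNReal.ofReal (r ^ (-α) / α) := by
  rw [← ofReal_integral_eq_lintegral_ofReal]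
  · rw [integral_Ioi_rpow_of_lt (by linarith) hr]
    congr 1
    have : -1 - α + 1 = -α := by ring
    rw [this]; field_simp
  · exact integrableOn_Ioi_rpow_of_lt (by linarith) hr
  · filter_upwards [ae_restrict_mem measurableSet_Ioi] with t ht
    exact Real.rpow_nonneg (hr.le.trans (le_of_lt ht)) _

lemma aux_hardy_point (p : ℝ) (hp : 1 ≤ p) (α r : ℝ) (ha : 0 < α) (hr : 0 < r)
    (G : ℝ → ℝ≥0∞) (hG : Measurable G) :
    (∫⁻ t in Set.Ioi r, G t) ^ p ≤ ENNReal.ofReal (r ^ (-α) / α) ^ (p - 1) *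
      ∫⁻ t in Set.Ioi r, G t ^ p * ENNReal.ofReal (t ^ ((1 + α) * (p - 1))) := by
  have h := aux_jensen (volume.restrict (Set.Ioi r)) p hp G
    (fun t => ENNReal.ofReal (t ^ (-1 - α))) hG (by fun_prop) ?_
  · rw [aux_lint_Ioi α r ha hr] at h
    refine h.trans_eq ?_
    congr 1
    apply setLIntegral_congr_fun measurableSet_Ioi
    intro t ht
    have ht0 : 0 < t := hr.trans ht
    simp only
    rw [ENNReal.ofReal_rpow_of_pos (by positivity), ← Real.rpow_mul ht0.le]
    congr 3; ring
  · filter_upwards [ae_restrict_mem measurableSet_Ioi] with t ht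
    have ht0 : 0 < t := hr.trans ht
    refine ⟨?_, ofReal_ne_top⟩
    rw [ne_eq, ENNReal.ofReal_eq_zero, not_le]; positivity

lemma aux_pow_mono (b r t : ℝ) (hb : 0 ≤ b) (hr : 0 < r) (hrt : r ≤ t) :
    r ^ b * (1 + r) ^ (-b) ≤ t ^ b * (1 + t) ^ (-b) := by
  have ht : 0 < t := hr.trans_le hrt
  rw [Real.rpow_neg (by positivity), Real.rpow_neg (by positivity), ← div_eq_mul_inv,
    ← div_eq_mul_inv, ← Real.div_rpow (by positivity) (by positivity),
    ← Real.div_rpow (by positivity) (by positivity)]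
  apply Real.rpow_le_rpow (by positivity) _ hb
  rw [div_le_div_iff₀ (by positivity) (by positivity)]
  nlinarith

lemma aux_Lam_mono (a b r t : ℝ) (ha : 0 < a) (hab : 0 < a + b) (hr : 0 < r) (hrt : r ≤ t) :
    r ^ a * (1 + r) ^ b ≤ t ^ a * (1 + t) ^ b := by
  have ht : 0 < t := hr.trans_le hrt
  rcases le_total 0 b with hb | hb
  · gcongr
  · have h := aux_pow_mono (-b) r t (by linarith) hr hrt
    rw [neg_neg] at h
    have e : ∀ x : ℝ, 0 < x → x ^ a * (1 + x) ^ b = x ^ (a + b) * (x ^ (-b) * (1 + x) ^ b) := by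
      intro x hx
      rw [← mul_assoc, ← Real.rpow_add hx]; congr 2; ring
    rw [e r hr, e t ht]
    gcongr

lemma aux_lam_int (a b t : ℝ) (ha : 0 < a) (hab : 0 < a + b) (ht : 0 < t) :
    ∫⁻ r in Set.Ioc 0 t, ENNReal.ofReal (r ^ (a - 1) * (1 + r) ^ b) ≤
      ENNReal.ofReal (1 / a + 1 / (a + b)) * ENNReal.ofReal (t ^ a * (1 + t) ^ b) := by
  rcases le_total 0 b with hb | hb
  · calc _ ≤ ∫⁻ r in Set.Ioc 0 t, ENNReal.ofReal (r ^ (a - 1)) * ENNReal.ofReal ((1 + t) ^ b) := by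
          apply setLIntegral_mono (by fun_prop)
          intro r hr
          rw [← ENNReal.ofReal_mul (Real.rpow_nonneg hr.1.le _)]
          apply ENNReal.ofReal_le_ofReal
          have := hr.1
          have := hr.2
          gcongr
      _ = ENNReal.ofReal (t ^ a / a) * ENNReal.ofReal ((1 + t) ^ b) := by
          rw [lintegral_mul_const _ (by fun_prop), aux_lint_Ioc a t ha ht.le]
      _ ≤ _ := by
          rw [← ENNReal.ofReal_mul (by positivity), ← ENNReal.ofReal_mul (by positivity)]
          apply ENNReal.ofReal_le_ofReal
          have : t ^ a / a * (1 + t) ^ b = 1 / a * (t ^ a * (1 + t) ^ b) := by ring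
          rw [this]
          gcongr
          have : 0 < 1 / (a + b) := by positivity
          linarith
  · calc _ ≤ ∫⁻ r in Set.Ioc 0 t, ENNReal.ofReal (r ^ (a + b - 1)) *
          ENNReal.ofReal (t ^ (-b) * (1 + t) ^ b) := by
          apply setLIntegral_mono (by fun_prop)
          intro r hr
          rw [← ENNReal.ofReal_mul (Real.rpow_nonneg hr.1.le _)]
          apply ENNReal.ofReal_le_ofReal
          have h1 := hr.1
          have h := aux_pow_mono (-b) r t (by linarith) hr.1 hr.2
          rw [neg_neg] at h
          have e : r ^ (a - 1) * (1 + r) ^ b = r ^ (a + b - 1) * (r ^ (-b) * (1 + r) ^ b) := by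
            rw [← mul_assoc, ← Real.rpow_add h1]; congr 2; ring
          rw [e]
          gcongr
      _ = ENNReal.ofReal (t ^ (a + b) / (a + b)) * ENNReal.ofReal (t ^ (-b) * (1 + t) ^ b) := by
          rw [lintegral_mul_const _ (by fun_prop), aux_lint_Ioc (a + b) t hab ht.le]
      _ ≤ _ := by
          rw [← ENNReal.ofReal_mul (by positivity), ← ENNReal.ofReal_mul (by positivity)]
          apply ENNReal.ofReal_le_ofReal
          have e : t ^ a = t ^ (a + b) * t ^ (-b) := by
            rw [← Real.rpow_add ht]; congr 1; ring
          have : t ^ (a + b) / (a + b) * (t ^ (-b) * (1 + t) ^ b) =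
            1 / (a + b) * (t ^ a * (1 + t) ^ b) := by rw [e]; ring
          rw [this]
          gcongr
          have : 0 < 1 / a := by positivity
          linarith

lemma aux_tonelli (k l : ℝ → ℝ≥0∞) (hk : Measurable k) (hl : Measurable l) :
    ∫⁻ r in Set.Ioi 0, (∫⁻ t in Set.Ioi r, k t) * l r =
      ∫⁻ t in Set.Ioi 0, k t * ∫⁻ r in Set.Ioo 0 t, l r := by
  have h1 : ∀ r ∈ Set.Ioi (0:ℝ), (∫⁻ t in Set.Ioi r, k t) * l r =
      ∫⁻ t in Set.Ioi 0, {z : ℝ × ℝ | z.1 < z.2}.indicator (fun z => k z.2 * l z.1) (r, t) := by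
    intro r hr
    rw [← lintegral_mul_const _ hk, ← lintegral_indicator measurableSet_Ioi,
      ← lintegral_indicator measurableSet_Ioi]
    congr 1; ext t
    simp only [Set.indicator, Set.mem_Ioi, Set.mem_ofPred_eq]
    have hr' : 0 < r := hr
    by_cases h : r < t
    · simp [h, hr'.trans h]
    · simp [h]
  have h2 : ∀ t ∈ Set.Ioi (0:ℝ), k t * (∫⁻ r in Set.Ioo 0 t, l r) =
      ∫⁻ r in Set.Ioi 0, {z : ℝ × ℝ | z.1 < z.2}.indicator (fun z => k z.2 * l z.1) (r, t) := by
    intro t ht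
    rw [← lintegral_const_mul _ hl, ← lintegral_indicator measurableSet_Ioo,
      ← lintegral_indicator measurableSet_Ioi]
    congr 1; ext r
    simp only [Set.indicator, Set.mem_Ioi, Set.mem_ofPred_eq, Set.mem_Ioo]
    by_cases h : r < t <;> by_cases h' : 0 < r <;> simp [h, h']
  rw [setLIntegral_congr_fun measurableSet_Ioi h1, setLIntegral_congr_fun measurableSet_Ioi h2]
  apply lintegral_lintegral_swap
  apply Measurable.aemeasurable
  apply Measurable.indicator
  · fun_prop
  · exact measurableSet_lt measurable_fst measurable_snd

lemma aux_tail_meas (k : ℝ → ℝ≥0∞) : Measurable (fun r => ∫⁻ t in Set.Ioi r, k t) := by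
  apply Antitone.measurable
  intro r r' h
  exact lintegral_mono_set (Set.Ioi_subset_Ioi h)

lemma aux_minkowski (k : ℝ → ℝ≥0∞) (hk : Measurable k) (a b m : ℝ) (ha : 0 < a)
    (hab : 0 < a + b) (hm : 1 ≤ m) :
    ∫⁻ r in Set.Ioi 0, (∫⁻ t in Set.Ioi r, k t) ^ m *
        ENNReal.ofReal (r ^ (a * m - 1) * (1 + r) ^ (b * m)) ≤
      ENNReal.ofReal (1 / a + 1 / (a + b)) *
        (∫⁻ t in Set.Ioi 0, k t * ENNReal.ofReal (t ^ a * (1 + t) ^ b)) ^ m := by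
  set M := ∫⁻ t in Set.Ioi 0, k t * ENNReal.ofReal (t ^ a * (1 + t) ^ b) with hM
  have hpt : ∀ r ∈ Set.Ioi (0:ℝ), (∫⁻ t in Set.Ioi r, k t) * ENNReal.ofReal (r ^ a * (1 + r) ^ b)
      ≤ M := by
    intro r hr
    rw [← lintegral_mul_const _ hk]
    calc _ ≤ ∫⁻ t in Set.Ioi r, k t * ENNReal.ofReal (t ^ a * (1 + t) ^ b) := by
            apply setLIntegral_mono (by fun_prop)
            intro t ht
            refine mul_le_mul_right (ENNReal.ofReal_le_ofReal ?_) _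
            exact aux_Lam_mono a b r t ha hab hr (le_of_lt ht)
      _ ≤ M := lintegral_mono_set (Set.Ioi_subset_Ioi (le_of_lt hr))
  have hpt2 : ∀ r ∈ Set.Ioi (0:ℝ), (∫⁻ t in Set.Ioi r, k t) ^ m *
        ENNReal.ofReal (r ^ (a * m - 1) * (1 + r) ^ (b * m)) ≤
        M ^ (m - 1) * ((∫⁻ t in Set.Ioi r, k t) * ENNReal.ofReal (r ^ (a - 1) * (1 + r) ^ b)) := by
    intro r hr
    have hr0 : 0 < r := hr
    have e1 : r ^ (a * m - 1) * (1 + r) ^ (b * m) =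
        (r ^ a * (1 + r) ^ b) ^ (m - 1) * (r ^ (a - 1) * (1 + r) ^ b) := by
      rw [Real.mul_rpow (by positivity) (by positivity), ← Real.rpow_mul hr0.le,
        ← Real.rpow_mul (by positivity), mul_mul_mul_comm, ← Real.rpow_add hr0,
        ← Real.rpow_add (by positivity)]
      congr 2 <;> ring
    have e2 : m = (m - 1) + 1 := by ring
    rw [e1, ENNReal.ofReal_mul (by positivity), ← ENNReal.ofReal_rpow_of_nonneg (by positivity) (by linarith)]
    conv_lhs => rw [e2, ENNReal.rpow_add_of_nonneg _ _ (by linarith) (by norm_num)]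
    rw [ENNReal.rpow_one]
    have e3 : m - 1 + 1 - 1 = m - 1 := by ring
    rw [e3, mul_mul_mul_comm, ← ENNReal.mul_rpow_of_nonneg _ _ (by linarith)]
    refine mul_le_mul_left (ENNReal.rpow_le_rpow (hpt r hr) (by linarith)) _
  calc _ ≤ ∫⁻ r in Set.Ioi 0, M ^ (m - 1) * ((∫⁻ t in Set.Ioi r, k t) *
          ENNReal.ofReal (r ^ (a - 1) * (1 + r) ^ b)) := by
          apply setLIntegral_mono _ hpt2
          have := aux_tail_meas k
          fun_prop
    _ = M ^ (m - 1) * ∫⁻ t in Set.Ioi 0, k t * ∫⁻ r in Set.Ioo 0 t,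
          ENNReal.ofReal (r ^ (a - 1) * (1 + r) ^ b) := by
          have := aux_tail_meas k
          rw [lintegral_const_mul _ (by fun_prop), aux_tonelli k _ hk (by fun_prop)]
    _ ≤ M ^ (m - 1) * ∫⁻ t in Set.Ioi 0, ENNReal.ofReal (1 / a + 1 / (a + b)) *
          (k t * ENNReal.ofReal (t ^ a * (1 + t) ^ b)) := by
          refine mul_le_mul_right ?_ _
          apply setLIntegral_mono (by fun_prop)
          intro t ht
          rw [mul_left_comm]
          gcongr
          exact (lintegral_mono_set Set.Ioo_subset_Ioc_self).trans (aux_lam_int a b t ha hab ht)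
    _ = _ := by
          rw [lintegral_const_mul _ (by fun_prop), ← hM]
          have e2 : m = (m - 1) + 1 := by ring
          conv_rhs => rw [e2, ENNReal.rpow_add_of_nonneg _ _ (by linarith) (by norm_num)]
          rw [ENNReal.rpow_one]; ring

lemma aux_exists_alpha (p s x : ℝ) (hp : 1 ≤ p) (hs : s < -1) (hx : 0 < x) :
    ∃ α : ℝ, 0 < α ∧ 0 < x - α * (p - 1) ∧ 0 < -(s + 1) * p - α * (p - 1) := by
  have h2 : 0 < -(s + 1) * p := by apply _root_.mul_pos <;> linarith
  have hm : 0 < min x (-(s + 1) * p) := lt_min hx h2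
  refine ⟨min x (-(s + 1) * p) / p, by positivity, ?_, ?_⟩
  all_goals
    have : min x (-(s + 1) * p) / p * (p - 1) < min x (-(s + 1) * p) := by
      rw [div_mul_eq_mul_div, div_lt_iff₀ (by linarith)]
      nlinarith
    have := min_le_left x (-(s + 1) * p)
    have := min_le_right x (-(s + 1) * p)
    linarith

lemma aux_hardy (n p q s : ℝ) (hn : 0 < n) (hp : 1 ≤ p) (hpq : p ≤ q) (hs : s < -1)
    (hI : 0 ≤ n * p / q + p - n) :
    ∃ C : ℝ≥0∞, C ≠ ⊤ ∧ ∀ G : ℝ → ℝ≥0∞, Measurable G →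
      ∫⁻ r in Set.Ioi 0, (∫⁻ t in Set.Ioi r, G t) ^ q *
        ENNReal.ofReal (r ^ (n - 1) * (1 + r) ^ (-(s + 1) * q - n)) ≤
      C * (∫⁻ t in Set.Ioi 0, G t ^ p *
        ENNReal.ofReal (t ^ (n - 1) * (1 + t) ^ (-s * p - n))) ^ (q / p) := by
  have hp0 : 0 < p := by linarith
  have hq0 : 0 < q := by linarith
  obtain ⟨α, hα, h1, h2⟩ := aux_exists_alpha p s (n * p / q) hp hs (by positivity)
  set a := n * p / q - α * (p - 1) with ha
  set b := -(s + 1) * p - n * p / q with hb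
  have hab : 0 < a + b := by rw [ha, hb]; linarith
  have hm : 1 ≤ q / p := by rw [le_div_iff₀ hp0]; linarith
  refine ⟨(ENNReal.ofReal ((1 / α) ^ ((p - 1) * (q / p)))) * ENNReal.ofReal (1 / a + 1 / (a + b)), by finiteness, ?_⟩
  intro G hG
  set k : ℝ → ℝ≥0∞ := fun t => G t ^ p * ENNReal.ofReal (t ^ ((1 + α) * (p - 1))) with hk
  have hkm : Measurable k := by fun_prop
  have hM := aux_minkowski k hkm a b (q / p) h1 hab hm
  calc _ ≤ ∫⁻ r in Set.Ioi 0, ENNReal.ofReal ((1 / α) ^ ((p - 1) * (q / p))) *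
        ((∫⁻ t in Set.Ioi r, k t) ^ (q / p) *
        ENNReal.ofReal (r ^ (a * (q / p) - 1) * (1 + r) ^ (b * (q / p)))) := by
          apply setLIntegral_mono
          · have := aux_tail_meas k
            fun_prop
          intro r hr
          have hr0 : 0 < r := hr
          have h := aux_hardy_point p hp α r hα hr G hG
          have h' : (∫⁻ t in Set.Ioi r, G t) ^ q ≤
            ENNReal.ofReal ((r ^ (-α) / α) ^ ((p - 1) * (q / p))) *
              (∫⁻ t in Set.Ioi r, k t) ^ (q / p) := by
            have := ENNReal.rpow_le_rpow h (z := q / p) (by positivity)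
            rw [← ENNReal.rpow_mul, ENNReal.mul_rpow_of_nonneg _ _ (by positivity),
              ← ENNReal.rpow_mul, ENNReal.ofReal_rpow_of_pos (by positivity)] at this
            have e : p * (q / p) = q := by field_simp
            rwa [e] at this
          calc _ ≤ ENNReal.ofReal ((r ^ (-α) / α) ^ ((p - 1) * (q / p))) *
              (∫⁻ t in Set.Ioi r, k t) ^ (q / p) *
              ENNReal.ofReal (r ^ (n - 1) * (1 + r) ^ (-(s + 1) * q - n)) := by gcongr
            _ = (∫⁻ t in Set.Ioi r, k t) ^ (q / p) * 
              (ENNReal.ofReal ((r ^ (-α) / α) ^ ((p - 1) * (q / p))) *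
              ENNReal.ofReal (r ^ (n - 1) * (1 + r) ^ (-(s + 1) * q - n))) := by ring
            _ = (∫⁻ t in Set.Ioi r, k t) ^ (q / p) * 
              (ENNReal.ofReal ((1 / α) ^ ((p - 1) * (q / p))) * 
              ENNReal.ofReal (r ^ (a * (q / p) - 1) * (1 + r) ^ (b * (q / p)))) := by
                congr 1
                rw [← ENNReal.ofReal_mul (by positivity), ← ENNReal.ofReal_mul (by positivity)]
                congr 1
                rw [div_eq_mul_one_div, Real.mul_rpow (by positivity) (by positivity),
                  ← Real.rpow_mul hr0.le]
                have e1 : a * (q / p) - 1 = -α * ((p - 1) * (q / p)) + (n - 1) := by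
                  rw [ha]; field_simp; ring
                have e2 : b * (q / p) = -(s + 1) * q - n := by
                  rw [hb]; field_simp
                rw [e1, e2, Real.rpow_add hr0]; ring
            _ = _ := by ring
    _ ≤ ENNReal.ofReal ((1 / α) ^ ((p - 1) * (q / p))) * (ENNReal.ofReal (1 / a + 1 / (a + b)) *
        (∫⁻ t in Set.Ioi 0, k t * ENNReal.ofReal (t ^ a * (1 + t) ^ b)) ^ (q / p)) := by
          rw [lintegral_const_mul]
          · gcongr
          · have := aux_tail_meas k
            fun_prop
    _ ≤ _ := by
          rw [mul_assoc]
          refine mul_le_mul_right (mul_le_mul_right (ENNReal.rpow_le_rpow ?_ (by positivity)) _) _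
          apply setLIntegral_mono (by fun_prop)
          intro t ht
          have ht0 : 0 < t := ht
          simp only [hk]
          rw [mul_assoc, ← ENNReal.ofReal_mul (by positivity)]
          refine mul_le_mul_right (ENNReal.ofReal_le_ofReal ?_) _
          have e1 : t ^ ((1 + α) * (p - 1)) * (t ^ a * (1 + t) ^ b) =
             t ^ (n - 1) * (t ^ (n * p / q + p - n) * (1 + t) ^ b) := by
            rw [← mul_assoc, ← mul_assoc, ← Real.rpow_add ht0, ← Real.rpow_add ht0]
            congr 2; rw [ha]; ring
          have e2 : -s * p - n = (n * p / q + p - n) + b := by rw [hb]; ring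
          rw [e1, e2, Real.rpow_add (by positivity : 0 < 1 + t)]
          gcongr
          linarith

lemma aux_tail_finite (n p s : ℝ) (hn : 0 < n) (hp : 1 ≤ p) (hs : s < -1) (r : ℝ) (hr : 0 < r)
    (G : ℝ → ℝ≥0∞) (hG : Measurable G)
    (hB : ∫⁻ t in Set.Ioi 0, G t ^ p *
        ENNReal.ofReal (t ^ (n - 1) * (1 + t) ^ (-s * p - n)) ≠ ⊤) :
    ∫⁻ t in Set.Ioi r, G t ≠ ⊤ := by
  intro htop
  obtain ⟨C, hC, h⟩ := aux_hardy n p p s hn hp le_rfl hs (by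
    have : n * p / p = n := by field_simp
    rw [this]; linarith)
  have h1 := h G hG
  have h2 : (⊤ : ℝ≥0∞) ≤ ∫⁻ r in Set.Ioi 0, (∫⁻ t in Set.Ioi r, G t) ^ p *
        ENNReal.ofReal (r ^ (n - 1) * (1 + r) ^ (-(s + 1) * p - n)) := by
    calc (⊤ : ℝ≥0∞) = ∫⁻ x in Set.Ioo 0 r, ⊤ := by simp [ENNReal.top_mul, hr]
      _ ≤ ∫⁻ x in Set.Ioo 0 r, (∫⁻ t in Set.Ioi x, G t) ^ p *
        ENNReal.ofReal (x ^ (n - 1) * (1 + x) ^ (-(s + 1) * p - n)) := by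
          apply setLIntegral_mono
          · have := aux_tail_meas G
            fun_prop
          intro x hx
          have hx0 := hx.1
          have : ∫⁻ t in Set.Ioi x, G t = ⊤ := by
            rw [eq_top_iff, ← htop]; exact lintegral_mono_set (Set.Ioi_subset_Ioi hx.2.le)
          rw [this, ENNReal.top_rpow_of_pos (by linarith), ENNReal.top_mul]
          rw [ne_eq, ENNReal.ofReal_eq_zero, not_le]; positivity
      _ ≤ _ := lintegral_mono_set Set.Ioo_subset_Ioi_self
  have h3 := h2.trans h1
  rw [top_le_iff] at h3
  have hp0 : 0 < p := by linarith
  rw [div_self hp0.ne', ENNReal.rpow_one] at h3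
  exact ENNReal.mul_ne_top hC hB h3

lemma aux_point_sup (n p s : ℝ) (hn : 1 ≤ n) (hp : n < p) (hs : s < -1) :
    ∃ C : ℝ≥0∞, C ≠ ⊤ ∧ ∀ G : ℝ → ℝ≥0∞, Measurable G → ∀ r : ℝ, 0 < r →
      (∫⁻ t in Set.Ioi r, G t) ^ p * ENNReal.ofReal ((1 + r) ^ (-(s + 1) * p)) ≤
      C * (∫⁻ t in Set.Ioi r, G t ^ p *
        ENNReal.ofReal (t ^ (n - 1) * (1 + t) ^ (-s * p - n))) := by
  have hp1 : 0 < p - 1 := by linarith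
  set β := -(s + 1) * p / (p - 1) with hβ
  set γ := (n - 1) / (p - 1) with hγ
  have hβ0 : 0 < β := div_pos (_root_.mul_pos (by linarith) (by linarith)) hp1
  have hγ0 : 0 ≤ γ := div_nonneg (by linarith) hp1.le
  have hγ1 : γ < 1 := by rw [hγ, div_lt_one hp1]; linarith
  set ρ : ℝ → ℝ := fun t => t ^ (-γ) * (1 + t) ^ (γ - 1 - β) with hρ
  have hρpos : ∀ t, 0 < t → 0 < ρ t := by intro t ht; simp only [hρ]; positivity
  have htail : ∀ r, 1 ≤ r → ∫⁻ t in Set.Ioi r, ENNReal.ofReal (ρ t) ≤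
      ENNReal.ofReal (r ^ (-β) / β) := by
    intro r hr
    rw [← aux_lint_Ioi β r hβ0 (by linarith)]
    apply setLIntegral_mono (by fun_prop)
    intro t ht
    apply ENNReal.ofReal_le_ofReal
    have ht0 : 0 < t := lt_trans (by linarith) (Set.mem_Ioi.1 ht)
    have : t ^ (-1 - β) = t ^ (-γ) * t ^ (γ - 1 - β) := by
      rw [← Real.rpow_add ht0]; congr 1; ring
    rw [this]
    simp only [hρ]
    gcongr ?_ * ?_
    exact Real.rpow_le_rpow_of_nonpos ht0 (by linarith) (by linarith)
  set D : ℝ := 2 ^ β * (1 / β + 1 / (1 - γ)) with hD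
  have h1γ : 0 < 1 - γ := by linarith
  have hD0 : 0 < D := by positivity
  have hInt : ∀ r, 0 < r → ∫⁻ t in Set.Ioi r, ENNReal.ofReal (ρ t) ≤
      ENNReal.ofReal (D * (1 + r) ^ (-β)) := by
    intro r hr
    rcases le_total 1 r with h | h
    · refine (htail r h).trans (ENNReal.ofReal_le_ofReal ?_)
      have e1 : r ^ (-β) ≤ 2 ^ β * (1 + r) ^ (-β) := by
        have : (2 * r) ^ (-β) ≤ (1 + r) ^ (-β) :=
          Real.rpow_le_rpow_of_nonpos (by linarith) (by linarith) (by linarith)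
        rw [Real.mul_rpow (by norm_num) hr.le, Real.rpow_neg (by norm_num),
          inv_mul_le_iff₀ (by positivity)] at this
        exact this
      calc r ^ (-β) / β ≤ (2 ^ β * (1 + r) ^ (-β)) / β := by gcongr
        _ = 2 ^ β * (1 / β) * (1 + r) ^ (-β) := by ring
        _ ≤ _ := by
          rw [hD]
          have : 0 < 1 / (1 - γ) := by positivity
          gcongr
          linarith
    · have hsub : Set.Ioi r ⊆ Set.Ioc 0 1 ∪ Set.Ioi 1 := by
        intro t ht
        rcases le_or_gt t 1 with h' | h'
        · left; exact ⟨hr.trans ht, h'⟩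
        · right; exact h'
      calc _ ≤ ∫⁻ t in Set.Ioc 0 1 ∪ Set.Ioi 1, ENNReal.ofReal (ρ t) := lintegral_mono_set hsub
        _ ≤ (∫⁻ t in Set.Ioc 0 1, ENNReal.ofReal (ρ t)) + ∫⁻ t in Set.Ioi 1, ENNReal.ofReal (ρ t) :=
            lintegral_union_le _ _ _
        _ ≤ ENNReal.ofReal (1 ^ (1 - γ) / (1 - γ)) + ENNReal.ofReal (1 ^ (-β) / β) := by
            gcongr ?_ + ?_
            · rw [← aux_lint_Ioc (1 - γ) 1 h1γ (by norm_num)]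
              apply setLIntegral_mono (by fun_prop)
              intro t ht
              have ht0 := ht.1
              apply ENNReal.ofReal_le_ofReal
              have : 1 - γ - 1 = -γ := by ring
              rw [this]
              simp only [hρ]
              apply mul_le_of_le_one_right (by positivity)
              exact Real.rpow_le_one_of_one_le_of_nonpos (by linarith) (by linarith)
            · exact htail 1 le_rfl
        _ ≤ _ := by
            rw [← ENNReal.ofReal_add (by positivity) (by positivity)]
            apply ENNReal.ofReal_le_ofReal
            rw [Real.one_rpow, Real.one_rpow, hD]
            have : (2:ℝ) ^ (-β) ≤ (1 + r) ^ (-β) :=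
              Real.rpow_le_rpow_of_nonpos (by linarith) (by linarith) (by linarith)
            have e : (1:ℝ) ≤ 2 ^ β * (1 + r) ^ (-β) := by
              rwa [Real.rpow_neg (by norm_num), inv_le_iff_one_le_mul₀ (by positivity), mul_comm] at this
            calc 1 / (1 - γ) + 1 / β = 1 * (1 / β + 1 / (1 - γ)) := by ring
              _ ≤ (2 ^ β * (1 + r) ^ (-β)) * (1 / β + 1 / (1 - γ)) := by gcongr
              _ = _ := by ring
  refine ⟨ENNReal.ofReal (D ^ (p - 1)), ofReal_ne_top, ?_⟩
  intro G hG r hr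
  have h := aux_jensen (volume.restrict (Set.Ioi r)) p (by linarith) G
    (fun t => ENNReal.ofReal (ρ t)) hG (by fun_prop) (by
      filter_upwards [ae_restrict_mem measurableSet_Ioi] with t ht
      refine ⟨?_, ofReal_ne_top⟩
      rw [ne_eq, ENNReal.ofReal_eq_zero, not_le]; exact hρpos t (hr.trans ht))
  have e1 : ∫⁻ t in Set.Ioi r, G t ^ p * ENNReal.ofReal (ρ t) ^ (1 - p) =
     ∫⁻ t in Set.Ioi r, G t ^ p * ENNReal.ofReal (t ^ (n - 1) * (1 + t) ^ (-s * p - n)) := by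
    apply setLIntegral_congr_fun measurableSet_Ioi
    intro t ht
    have ht0 : 0 < t := hr.trans ht
    simp only
    rw [ENNReal.ofReal_rpow_of_pos (hρpos t ht0)]
    simp only [hρ]
    rw [Real.mul_rpow (by positivity) (by positivity), ← Real.rpow_mul ht0.le,
      ← Real.rpow_mul (by positivity)]
    congr 4
    · rw [hγ]; field_simp; ring
    · rw [hγ, hβ]; field_simp; ring
  rw [e1] at h
  calc _ ≤ (ENNReal.ofReal (D * (1 + r) ^ (-β)) ^ (p - 1) *
      ∫⁻ t in Set.Ioi r, G t ^ p * ENNReal.ofReal (t ^ (n - 1) * (1 + t) ^ (-s * p - n))) * 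
      ENNReal.ofReal ((1 + r) ^ (-(s + 1) * p)) := by
        gcongr
        refine h.trans ?_
        gcongr
        exact hInt r hr
    _ = (ENNReal.ofReal (D * (1 + r) ^ (-β)) ^ (p - 1) * ENNReal.ofReal ((1 + r) ^ (-(s + 1) * p))) *
      ∫⁻ t in Set.Ioi r, G t ^ p * ENNReal.ofReal (t ^ (n - 1) * (1 + t) ^ (-s * p - n)) := by ring
    _ = _ := by
        congr 1
        rw [ENNReal.ofReal_rpow_of_pos (by positivity), ← ENNReal.ofReal_mul (by positivity)]
        congr 1
        rw [Real.mul_rpow (by positivity) (by positivity), ← Real.rpow_mul (by positivity),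
          mul_assoc, ← Real.rpow_add (by positivity)]
        have : -β * (p - 1) + -(s + 1) * p = 0 := by rw [hβ]; field_simp; ring
        rw [this]; simp

lemma aux_polar_lintegral {N : ℕ} (hN : 1 < N) (Φ : EuclideanSpace ℝ (Fin N) → ℝ≥0∞)
    (hΦ : Measurable Φ) :
    ∫⁻ x, Φ x = ∫⁻ r in Set.Ioi (0:ℝ), ENNReal.ofReal (r ^ (N - 1)) *
      ∫⁻ σ : sphere (0 : EuclideanSpace ℝ (Fin N)) 1, Φ (r • (σ : EuclideanSpace ℝ (Fin N)))
        ∂((volume : Measure (EuclideanSpace ℝ (Fin N))).toSphere) := by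
  have : Nonempty (Fin N) := ⟨⟨0, by omega⟩⟩
  set τ := (volume : Measure (EuclideanSpace ℝ (Fin N))).toSphere
  have hm : Measurable (fun z : sphere (0:(EuclideanSpace ℝ (Fin N))) 1 × ℝ => Φ (z.2 • (z.1 : (EuclideanSpace ℝ (Fin N))))) := by fun_prop
  have hm2 : Measurable (fun r : ℝ => ∫⁻ σ : sphere (0:(EuclideanSpace ℝ (Fin N))) 1, Φ (r • (σ : (EuclideanSpace ℝ (Fin N)))) ∂τ) :=
    hm.lintegral_prod_left'
  calc ∫⁻ x, Φ x = ∫⁻ x : ({(0:(EuclideanSpace ℝ (Fin N)))}ᶜ : Set (EuclideanSpace ℝ (Fin N))), Φ x ∂((volume : Measure (EuclideanSpace ℝ (Fin N))).comap (↑)) := by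
        rw [lintegral_subtype_comap (measurableSet_singleton _).compl, restrict_compl_singleton]
    _ = ∫⁻ z : sphere (0:(EuclideanSpace ℝ (Fin N))) 1 × Set.Ioi (0:ℝ), Φ (z.2.1 • (z.1 : (EuclideanSpace ℝ (Fin N))))
          ∂(τ.prod (.volumeIoiPow (Module.finrank ℝ (EuclideanSpace ℝ (Fin N)) - 1))) := by
        rw [← (volume : Measure (EuclideanSpace ℝ (Fin N))).measurePreserving_homeomorphUnitSphereProd.lintegral_comp_emb
          (Homeomorph.measurableEmbedding _)]
        apply lintegral_congr
        intro x
        simp only [homeomorphUnitSphereProd_apply_snd_coe, homeomorphUnitSphereProd_apply_fst_coe]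
        rw [smul_smul, mul_inv_cancel₀ (norm_ne_zero_iff.2 x.2), one_smul]
    _ = ∫⁻ r : Set.Ioi (0:ℝ), ∫⁻ σ, Φ (r.1 • (σ : (EuclideanSpace ℝ (Fin N)))) ∂τ
          ∂(.volumeIoiPow (Module.finrank ℝ (EuclideanSpace ℝ (Fin N)) - 1)) := by
        rw [lintegral_prod_symm]
        apply Measurable.aemeasurable
        exact hm.comp (measurable_fst.prodMk (measurable_subtype_coe.comp measurable_snd))
    _ = _ := by
        have hf : Module.finrank ℝ (EuclideanSpace ℝ (Fin N)) = N := by simp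
        rw [hf, Measure.volumeIoiPow, lintegral_withDensity_eq_lintegral_mul]
        · rw [← lintegral_subtype_comap measurableSet_Ioi]; rfl
        · fun_prop
        · exact hm2.comp measurable_subtype_coe

lemma aux_polar_integral {N : ℕ} (hN : 1 < N) (Φ : EuclideanSpace ℝ (Fin N) → ℝ)
    (hi : Integrable Φ) :
    ∫ x, Φ x = ∫ r in Set.Ioi (0:ℝ), r ^ (N - 1) *
      ∫ σ : sphere (0 : EuclideanSpace ℝ (Fin N)) 1, Φ (r • (σ : EuclideanSpace ℝ (Fin N)))
        ∂((volume : Measure (EuclideanSpace ℝ (Fin N))).toSphere) := by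
  have : Nonempty (Fin N) := ⟨⟨0, by omega⟩⟩
  set τ := (volume : Measure (EuclideanSpace ℝ (Fin N))).toSphere
  have key : ∀ x : ({(0:(EuclideanSpace ℝ (Fin N)))}ᶜ : Set (EuclideanSpace ℝ (Fin N))), Φ x = (fun z : sphere (0:(EuclideanSpace ℝ (Fin N))) 1 × Set.Ioi (0:ℝ) => Φ (z.2.1 • (z.1 : (EuclideanSpace ℝ (Fin N))))) (homeomorphUnitSphereProd (EuclideanSpace ℝ (Fin N)) x) := by
    intro x
    simp only [homeomorphUnitSphereProd_apply_snd_coe, homeomorphUnitSphereProd_apply_fst_coe]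
    rw [smul_smul, mul_inv_cancel₀ (norm_ne_zero_iff.2 x.2), one_smul]
  have hInt : Integrable (fun z : sphere (0:(EuclideanSpace ℝ (Fin N))) 1 × Set.Ioi (0:ℝ) => Φ (z.2.1 • (z.1 : (EuclideanSpace ℝ (Fin N)))))
      (τ.prod (.volumeIoiPow (Module.finrank ℝ (EuclideanSpace ℝ (Fin N)) - 1))) := by
    rw [← (volume : Measure (EuclideanSpace ℝ (Fin N))).measurePreserving_homeomorphUnitSphereProd.integrable_comp_emb
          (Homeomorph.measurableEmbedding _)]
    have h1 : Integrable (fun x : ({(0:(EuclideanSpace ℝ (Fin N)))}ᶜ : Set (EuclideanSpace ℝ (Fin N))) => Φ x) ((volume : Measure (EuclideanSpace ℝ (Fin N))).comap (↑)) := by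
      have := (integrableOn_iff_comap_subtypeVal (μ := (volume : Measure (EuclideanSpace ℝ (Fin N)))) (f := Φ) 
        (measurableSet_singleton (0:(EuclideanSpace ℝ (Fin N)))).compl).1 hi.integrableOn
      exact this
    refine h1.congr (.of_forall fun x => ?_)
    exact key x
  calc ∫ x, Φ x = ∫ x : ({(0:(EuclideanSpace ℝ (Fin N)))}ᶜ : Set (EuclideanSpace ℝ (Fin N))), Φ x ∂((volume : Measure (EuclideanSpace ℝ (Fin N))).comap (↑)) := by
        rw [integral_subtype_comap (measurableSet_singleton _).compl, restrict_compl_singleton]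
    _ = ∫ z : sphere (0:(EuclideanSpace ℝ (Fin N))) 1 × Set.Ioi (0:ℝ), Φ (z.2.1 • (z.1 : (EuclideanSpace ℝ (Fin N))))
          ∂(τ.prod (.volumeIoiPow (Module.finrank ℝ (EuclideanSpace ℝ (Fin N)) - 1))) := by
        rw [← (volume : Measure (EuclideanSpace ℝ (Fin N))).measurePreserving_homeomorphUnitSphereProd.integral_comp
          (Homeomorph.measurableEmbedding _)]
        apply integral_congr_ae
        exact .of_forall key
    _ = ∫ r : Set.Ioi (0:ℝ), ∫ σ, Φ (r.1 • (σ : (EuclideanSpace ℝ (Fin N)))) ∂τ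
          ∂(.volumeIoiPow (Module.finrank ℝ (EuclideanSpace ℝ (Fin N)) - 1)) := by
        rw [integral_prod_symm _ hInt]
    _ = _ := by
        have hf : Module.finrank ℝ (EuclideanSpace ℝ (Fin N)) = N := by simp
        simp only [Measure.volumeIoiPow, ENNReal.ofReal]
        rw [hf, integral_withDensity_eq_integral_smul,
          integral_subtype_comap measurableSet_Ioi fun a ↦ Real.toNNReal (a ^ (N - 1)) •
            (∫ σ : sphere (0:(EuclideanSpace ℝ (Fin N))) 1, Φ (a • (σ : (EuclideanSpace ℝ (Fin N)))) ∂τ),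
          setIntegral_congr_fun measurableSet_Ioi fun x hx ↦ ?_]
        · rw [NNReal.smul_def, Real.coe_toNNReal _ (pow_nonneg hx.out.le _), smul_eq_mul]
        · exact (measurable_subtype_coe.pow_const _).real_toNNReal

lemma aux_ae_norm {N : ℕ} (hN : 1 < N) (P : ℝ → Prop)
    (h : ∀ᵐ r ∂(volume.restrict (Set.Ioi (0:ℝ))), P r) :
    ∀ᵐ x : EuclideanSpace ℝ (Fin N), P ‖x‖ := by
  have : Nonempty (Fin N) := ⟨⟨0, by omega⟩⟩
  obtain ⟨t, hts, htm, ht0⟩ := exists_measurable_superset_of_null (ae_iff.1 h)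
  have hm : Measurable (fun x : EuclideanSpace ℝ (Fin N) => t.indicator (1 : ℝ → ℝ≥0∞) ‖x‖) :=
    (measurable_one.indicator htm).comp measurable_norm
  have h1 := aux_polar_lintegral hN (fun x => t.indicator (1 : ℝ → ℝ≥0∞) ‖x‖) hm
  have h2 : ∫⁻ x : EuclideanSpace ℝ (Fin N), t.indicator (1 : ℝ → ℝ≥0∞) ‖x‖ = 0 := by
    rw [h1]
    have : ∀ᵐ r ∂(volume.restrict (Set.Ioi (0:ℝ))), r ∉ t := by
      rw [ae_iff]; simpa using ht0
    rw [lintegral_congr_ae (g := fun _ => 0)]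
    · simp
    · filter_upwards [this, ae_restrict_mem measurableSet_Ioi] with r hr hr0
      have hr0' : (0:ℝ) < r := hr0
      simp [norm_smul, abs_of_pos hr0', hr]
  rw [lintegral_eq_zero_iff hm] at h2
  filter_upwards [h2] with x hx
  by_contra hP
  have : ‖x‖ ∈ t := hts hP
  simp [this] at hx

/-- tail integral and integration by parts -/
lemma aux_parts (F : ℝ → ℝ) (hF : ∀ r, 0 < r → IntegrableOn F (Set.Ioi r))
    (η : ℝ → ℝ) (h1 : ContDiff ℝ (⊤ : ℕ∞) η) (h2 : HasCompactSupport η)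
    (h3 : tsupport η ⊆ Set.Ioi 0) :
    ∫ r in Set.Ioi 0, (∫ t in Set.Ioi r, F t) * deriv η r = ∫ t in Set.Ioi 0, F t * η t := by
  obtain ⟨a, ha0, ha⟩ : ∃ a : ℝ, 0 < a ∧ tsupport η ⊆ Set.Ioi a := by
    rcases (tsupport η).eq_empty_or_nonempty with he | hne
    · exact ⟨1, one_pos, by simp [he]⟩
    · have hc : IsCompact (tsupport η) := h2
      obtain ⟨m, hm, hmin⟩ := hc.exists_isMinOn hne continuous_id.continuousOn
      have hm0 : 0 < m := h3 hm
      refine ⟨m / 2, by positivity, fun x hx => ?_⟩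
      have : m ≤ x := hmin hx
      simp only [Set.mem_Ioi]; linarith
  have hd0 : ∀ r, r ≤ a → deriv η r = 0 := by
    intro r hr
    by_contra h
    have : r ∈ tsupport η := support_deriv_subset h
    exact absurd (ha this) (by simp [hr])
  have hdc : Continuous (deriv η) := h1.continuous_deriv (by simp)
  have hdi : Integrable (deriv η) := hdc.integrable_of_hasCompactSupport h2.deriv
  set K : ℝ × ℝ → ℝ := {z : ℝ × ℝ | z.1 < z.2}.indicator
    (fun z => deriv η z.1 * (Set.Ioi a).indicator F z.2) with hK
  have hKi : Integrable K (volume.prod volume) := by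
    apply Integrable.indicator
    · exact hdi.mul_prod ((integrable_indicator_iff measurableSet_Ioi).2 (hF a ha0))
    · exact measurableSet_lt measurable_fst measurable_snd
  have hs := integral_integral_swap (f := fun r t => K (r, t)) hKi
  have e1 : ∀ r, ∫ t, K (r, t) = (Set.Ioi 0).indicator (fun r => (∫ t in Set.Ioi r, F t) * deriv η r) r := by
    intro r
    by_cases hr : r ≤ a
    · simp only [hK, Set.indicator]
      simp [hd0 r hr]
    · rw [not_le] at hr
      rw [Set.indicator_of_mem (show r ∈ Set.Ioi 0 from ha0.trans hr), mul_comm, ← integral_const_mul,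
        ← integral_indicator measurableSet_Ioi]
      congr 1; ext t
      simp only [hK, Set.indicator, Set.mem_Ioi, Set.mem_ofPred_eq]
      by_cases h : r < t
      · simp [h, hr.trans h]
      · simp [h]
  have e2 : ∀ t, ∫ r, K (r, t) = (Set.Ioi 0).indicator (fun t => F t * η t) t := by
    intro t
    by_cases ht : t ≤ a
    · have : η t = 0 := by
        by_contra h
        exact absurd (ha (subset_tsupport _ h)) (by simp [ht])
      have h' : ¬ (a < t) := not_lt.2 ht
      simp only [hK, Set.indicator]
      simp [this, h']
    · rw [not_le] at ht
      have : ∀ r, K (r, t) = F t * (Set.Iio t).indicator (deriv η) r := by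
        intro r
        simp only [hK, Set.indicator, Set.mem_Ioi, Set.mem_ofPred_eq, Set.mem_Iio]
        by_cases h : r < t
        · simp [h, ht]; ring
        · simp [h]
      simp_rw [this]
      rw [integral_const_mul, integral_indicator measurableSet_Iio,
        Set.indicator_of_mem (show t ∈ Set.Ioi 0 from ha0.trans ht)]
      congr 1
      rw [← integral_Iic_eq_integral_Iio]
      have := HasCompactSupport.integral_Iic_deriv_eq (h1.of_le (by simp)) h2 t
      exact this
  simp_rw [e1, e2] at hs
  rwa [integral_indicator measurableSet_Ioi, integral_indicator measurableSet_Ioi] at hs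

lemma aux_antideriv (ξ : ℝ → ℝ) (h1 : ContDiff ℝ (⊤ : ℕ∞) ξ) (h2 : HasCompactSupport ξ)
    (h3 : tsupport ξ ⊆ Set.Ioi 0) (h0 : ∫ x, ξ x = 0) :
    ∃ η : ℝ → ℝ, ContDiff ℝ (⊤ : ℕ∞) η ∧ HasCompactSupport η ∧ tsupport η ⊆ Set.Ioi 0 ∧
      deriv η = ξ := by
  obtain ⟨a, b, ha0, hab, hs⟩ : ∃ a b : ℝ, 0 < a ∧ a ≤ b ∧ tsupport ξ ⊆ Set.Icc a b := by
    rcases (tsupport ξ).eq_empty_or_nonempty with he | hne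
    · exact ⟨1, 1, one_pos, le_rfl, by simp [he]⟩
    · have hc : IsCompact (tsupport ξ) := h2
      obtain ⟨m, hm, hmin⟩ := hc.exists_isMinOn hne continuous_id.continuousOn
      obtain ⟨M, hM, hmax⟩ := hc.exists_isMaxOn hne continuous_id.continuousOn
      exact ⟨m, M, h3 hm, hmin hM, fun x hx => ⟨hmin hx, hmax hx⟩⟩
  have hc := h1.continuous
  have hz : ∀ x, x ∉ Set.Icc a b → ξ x = 0 := by
    intro x hx
    by_contra h
    exact hx (hs (subset_tsupport _ h))
  set η : ℝ → ℝ := fun r => ∫ t in a..r, ξ t with hη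
  have hd : ∀ r, HasDerivAt η (ξ r) r := fun r =>
    intervalIntegral.integral_hasDerivAt_right (hc.intervalIntegrable _ _)
      (hc.stronglyMeasurableAtFilter _ _) hc.continuousAt
  have hd' : deriv η = ξ := funext fun r => (hd r).deriv
  have hsupp : Function.support η ⊆ Set.Icc a b := by
    intro r hr
    by_contra hrn
    apply hr
    simp only [hη]
    rcases lt_or_ge r a with h | h
    · apply intervalIntegral.integral_zero_ae
      refine .of_forall fun t ht => ?_
      rw [Set.uIoc_of_ge h.le] at ht
      rcases ht.2.lt_or_eq with h' | h'
      · exact hz t (fun h'' => absurd h''.1 (not_le.2 h'))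
      · rw [h']
        have hcl : Tendsto ξ (𝓝[<] a) (𝓝 (ξ a)) := hc.continuousAt.tendsto.mono_left nhdsWithin_le_nhds
        have hcl0 : Tendsto ξ (𝓝[<] a) (𝓝 0) := by
          apply tendsto_const_nhds.congr'
          filter_upwards [self_mem_nhdsWithin] with y hy
          exact (hz y (fun h'' => absurd h''.1 (not_le.2 hy))).symm
        exact tendsto_nhds_unique hcl hcl0
    · have hb : b < r := by
        by_contra hb
        exact hrn ⟨h, not_lt.1 hb⟩
      rw [intervalIntegral.integral_of_le h, ← integral_Icc_eq_integral_Ioc,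
        setIntegral_eq_integral_of_forall_compl_eq_zero, h0]
      intro x hx
      apply hz
      intro hx'
      exact hx ⟨hx'.1, hx'.2.trans hb.le⟩
  have hts : tsupport η ⊆ Set.Icc a b := closure_minimal hsupp isClosed_Icc
  refine ⟨η, ?_, ?_, hts.trans (fun x hx => ha0.trans_le hx.1), hd'⟩
  · rw [contDiff_infty_iff_deriv, hd']
    exact ⟨fun r => (hd r).differentiableAt, h1⟩
  · exact HasCompactSupport.of_support_subset_isCompact isCompact_Icc hsupp

lemma aux_const (k : ℝ → ℝ) (hk : LocallyIntegrableOn k (Set.Ioi 0))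
    (h : ∀ η : ℝ → ℝ, ContDiff ℝ (⊤ : ℕ∞) η → HasCompactSupport η → tsupport η ⊆ Set.Ioi 0 →
      ∫ r in Set.Ioi 0, k r * deriv η r = 0) :
    ∃ c, ∀ᵐ r ∂(volume.restrict (Set.Ioi (0:ℝ))), k r = c := by
  let B : ContDiffBump (2:ℝ) := ⟨1/2, 1, by norm_num, by norm_num⟩
  set η0 : ℝ → ℝ := B.normed volume with hη0
  have a1 : ContDiff ℝ (⊤ : ℕ∞) η0 := B.contDiff_normed
  have a2 : HasCompactSupport η0 := B.hasCompactSupport_normed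
  have a3 : tsupport η0 ⊆ Set.Ioi 0 := by
    rw [hη0, B.tsupport_normed_eq]
    intro x hx
    rw [mem_closedBall, Real.dist_eq, abs_le] at hx
    have := hx.1
    simp only [B] at this
    simp only [Set.mem_Ioi]; linarith
  have a4 : ∫ x, η0 x = 1 := B.integral_normed
  have hInt : ∀ ψ : ℝ → ℝ, Continuous ψ → HasCompactSupport ψ → tsupport ψ ⊆ Set.Ioi 0 →
      IntegrableOn (fun r => k r * ψ r) (Set.Ioi 0) := by
    intro ψ h1 h2 h3
    have h4 : IntegrableOn (fun r => k r * ψ r) (tsupport ψ) := by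
      apply IntegrableOn.mul_continuousOn _ h1.continuousOn h2
      exact hk.integrableOn_compact_subset h3 h2
    have h5 : Integrable (fun r => k r * ψ r) := by
      rw [← integrableOn_iff_integrable_of_support_subset (s := tsupport ψ)]
      · exact h4
      · intro x hx
        apply subset_tsupport
        intro h0
        apply hx
        simp [h0]
    exact h5.integrableOn
  set c := ∫ r in Set.Ioi 0, k r * η0 r with hc
  refine ⟨c, ?_⟩
  rw [ae_restrict_iff' measurableSet_Ioi]
  have := isOpen_Ioi.ae_eq_zero_of_integral_contDiff_smul_eq_zero (U := Set.Ioi (0:ℝ))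
    (f := fun r => k r - c) (μ := volume) (hk.sub (locallyIntegrableOn_const c)) ?_
  · filter_upwards [this] with r hr h0
    linarith [hr h0]
  · intro ψ h1 h2 h3
    have hzero : ∀ ψ : ℝ → ℝ, tsupport ψ ⊆ Set.Ioi 0 → ∀ x, x ∉ Set.Ioi (0:ℝ) → ψ x = 0 := by
      intro ψ h3 x hx
      by_contra h0
      exact hx (h3 (subset_tsupport _ h0))
    set I := ∫ x, ψ x with hI
    have iψ : Integrable ψ := h1.continuous.integrable_of_hasCompactSupport h2
    have iη : Integrable η0 := a1.continuous.integrable_of_hasCompactSupport a2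
    have b2 : HasCompactSupport (fun x => I * η0 x) := a2.mul_left
    have b3 : tsupport (fun x => I * η0 x) ⊆ Set.Ioi 0 := (tsupport_mul_subset_right).trans a3
    obtain ⟨η, c1, c2, c3, c4⟩ := aux_antideriv (fun x => ψ x - I * η0 x) (by fun_prop)
      (h2.sub b2) ((tsupport_sub _ _).trans (Set.union_subset h3 b3)) (by
        rw [integral_sub iψ (iη.const_mul I), integral_const_mul, a4, ← hI]; ring)
    have hh := h η c1 c2 c3
    rw [c4] at hh
    have d1 := hInt ψ h1.continuous h2 h3
    have d2 := hInt η0 a1.continuous a2 a3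
    have e1 : ∀ r, k r * (ψ r - I * η0 r) = k r * ψ r - I * (k r * η0 r) := by intro r; ring
    simp_rw [e1] at hh
    rw [integral_sub d1 (d2.const_mul I), integral_const_mul, ← hc] at hh
    rw [← setIntegral_eq_integral_of_forall_compl_eq_zero (s := Set.Ioi (0:ℝ))]
    · have e2 : ∀ r, ψ r • (k r - c) = k r * ψ r - c * ψ r := by intro r; simp; ring
      simp_rw [e2]
      rw [integral_sub d1 (iψ.integrableOn.const_mul c), integral_const_mul,
        setIntegral_eq_integral_of_forall_compl_eq_zero (hzero ψ h3), ← hI]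
      linarith
    · intro x hx
      simp [hzero ψ h3 x hx]

lemma aux_repr (f F : ℝ → ℝ) (hf : LocallyIntegrableOn f (Set.Ioi 0))
    (hF : ∀ r, 0 < r → IntegrableOn F (Set.Ioi r))
    (h : ∀ η : ℝ → ℝ, ContDiff ℝ (⊤ : ℕ∞) η → HasCompactSupport η → tsupport η ⊆ Set.Ioi 0 →
      ∫ r in Set.Ioi 0, f r * deriv η r = - ∫ r in Set.Ioi 0, F r * η r) :
    ∃ c, ∀ᵐ r ∂(volume.restrict (Set.Ioi (0:ℝ))), f r - c = - ∫ t in Set.Ioi r, F t := by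
  have hcont : ContinuousOn (fun r => ∫ t in Set.Ioi r, F t) (Set.Ioi 0) := by
    intro r0 hr0
    have hr0' : (0:ℝ) < r0 := hr0
    apply ContinuousAt.continuousWithinAt
    have hF2 := hF (r0 / 2) (by positivity)
    have e : ∀ r ∈ Set.Ioi (r0/2), ∫ t in Set.Ioi r, F t =
        (∫ t in Set.Ioi (r0/2), F t) - ∫ t in (r0/2)..r, (Set.Ioi (r0/2)).indicator F t := by
      intro r hr
      have hr' : r0/2 < r := hr
      rw [intervalIntegral.integral_of_le hr'.le, setIntegral_congr_fun (g := F) measurableSet_Ioc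
        (fun x hx => Set.indicator_of_mem (show x ∈ Set.Ioi (r0/2) from hx.1) F)]
      rw [← Set.Ioc_union_Ioi_eq_Ioi hr'.le, setIntegral_union (Set.Ioc_disjoint_Ioi le_rfl)
        measurableSet_Ioi (hF2.mono_set Set.Ioc_subset_Ioi_self) (hF2.mono_set (Set.Ioi_subset_Ioi hr'.le))]
      ring
    have hi : Integrable ((Set.Ioi (r0/2)).indicator F) := (integrable_indicator_iff measurableSet_Ioi).2 hF2
    have hc2 : Continuous (fun r => (∫ t in Set.Ioi (r0/2), F t) - ∫ t in (r0/2)..r, (Set.Ioi (r0/2)).indicator F t) :=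
      continuous_const.sub (intervalIntegral.continuous_primitive (fun a b => hi.intervalIntegrable) _)
    apply hc2.continuousAt.congr
    filter_upwards [Ioi_mem_nhds (show r0/2 < r0 by linarith)] with r hr
    exact (e r hr).symm
  have hHl : LocallyIntegrableOn (fun r => ∫ t in Set.Ioi r, F t) (Set.Ioi 0) :=
    hcont.locallyIntegrableOn measurableSet_Ioi
  have hInt : ∀ k : ℝ → ℝ, LocallyIntegrableOn k (Set.Ioi 0) → ∀ ψ : ℝ → ℝ, Continuous ψ → HasCompactSupport ψ → tsupport ψ ⊆ Set.Ioi 0 →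
      IntegrableOn (fun r => k r * ψ r) (Set.Ioi 0) := by
    intro k hk ψ h1 h2 h3
    have h4 : IntegrableOn (fun r => k r * ψ r) (tsupport ψ) := by
      apply IntegrableOn.mul_continuousOn _ h1.continuousOn h2
      exact hk.integrableOn_compact_subset h3 h2
    have h5 : Integrable (fun r => k r * ψ r) := by
      rw [← integrableOn_iff_integrable_of_support_subset (s := tsupport ψ)]
      · exact h4
      · intro x hx
        apply subset_tsupport
        intro h0
        apply hx
        simp [h0]
    exact h5.integrableOn
  obtain ⟨c, hc⟩ := aux_const (fun r => f r + ∫ t in Set.Ioi r, F t) (hf.add hHl) (by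
    intro η h1 h2 h3
    have hdc : Continuous (deriv η) := h1.continuous_deriv (by simp)
    have h3' : tsupport (deriv η) ⊆ Set.Ioi 0 :=
      (closure_minimal support_deriv_subset (isClosed_tsupport η)).trans h3
    have i1 := hInt f hf _ hdc h2.deriv h3'
    have i2 := hInt _ hHl _ hdc h2.deriv h3'
    simp_rw [add_mul]
    rw [integral_add i1 i2, h η h1 h2 h3, aux_parts F hF η h1 h2 h3]
    ring)
  refine ⟨c, ?_⟩
  filter_upwards [hc] with r hr
  linarith

lemma aux_test {N : ℕ} (hN : 1 < N) (η : ℝ → ℝ) (h1 : ContDiff ℝ (⊤ : ℕ∞) η)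
    (h2 : HasCompactSupport η) (h3 : tsupport η ⊆ Set.Ioi 0) :
    ∃ φ : Fin N → Euc N → ℝ, (∀ i, ContDiff ℝ (⊤ : ℕ∞) (φ i)) ∧ (∀ i, HasCompactSupport (φ i)) ∧
      (∀ i x, φ i x = (η ‖x‖ * (‖x‖ ^ N)⁻¹) * x i) ∧
      ∀ x, ∑ i, fderiv ℝ (φ i) x (EuclideanSpace.single i 1) =
        deriv η ‖x‖ * ‖x‖ * (‖x‖ ^ N)⁻¹ := by
  obtain ⟨a, ha0, ha⟩ : ∃ a : ℝ, 0 < a ∧ tsupport η ⊆ Set.Ioi a := by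
    rcases (tsupport η).eq_empty_or_nonempty with he | hne
    · exact ⟨1, one_pos, by simp [he]⟩
    · have hc : IsCompact (tsupport η) := h2
      obtain ⟨m, hm, hmin⟩ := hc.exists_isMinOn hne continuous_id.continuousOn
      have hm0 : 0 < m := h3 hm
      refine ⟨m / 2, by positivity, fun x hx => ?_⟩
      have : m ≤ x := hmin hx
      simp only [Set.mem_Ioi]; linarith
  have hz : ∀ r, r < a → η r = 0 := fun r hr => by
    apply image_eq_zero_of_notMem_tsupport
    intro h
    exact absurd (ha h) (by simp only [Set.mem_Ioi]; linarith)
  obtain ⟨R, hR⟩ : ∃ R : ℝ, tsupport η ⊆ closedBall 0 R :=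
    (h2 : IsCompact (tsupport η)).isBounded.subset_closedBall 0
  set ψ : ℝ → ℝ := fun t => η (√t) * ((√t) ^ N)⁻¹ with hψ
  have hψ1 : ContDiff ℝ (⊤ : ℕ∞) ψ := by
    rw [contDiff_iff_contDiffAt]
    intro t
    rcases le_or_gt t 0 with ht | ht
    · have : ψ =ᶠ[𝓝 t] fun _ => 0 := by
        have : ∀ᶠ t' in 𝓝 t, √t' < a := by
          apply (Real.continuous_sqrt.tendsto t).eventually_lt_const
          rw [Real.sqrt_eq_zero_of_nonpos ht]; exact ha0
        filter_upwards [this] with t' ht'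
        simp [hψ, hz _ ht']
      exact contDiffAt_const.congr_of_eventuallyEq this
    · have hs : ContDiffAt ℝ (⊤ : ℕ∞) (fun t : ℝ => √t) t := Real.contDiffAt_sqrt ht.ne'
      refine (h1.contDiffAt.comp t hs).mul ((hs.pow N).inv ?_)
      have := Real.sqrt_pos.2 ht
      positivity
  have hψd : Differentiable ℝ ψ := hψ1.differentiable (by simp)
  have hψ' : ∀ r, 0 < r → 2 * r ^ 2 * deriv ψ (r ^ 2) + N * ψ (r ^ 2) = 
      deriv η r * r * (r ^ N)⁻¹ := by
    intro r hr
    have e1 : HasDerivAt (fun r => ψ (r ^ 2)) (deriv ψ (r ^ 2) * (2 * r)) r := by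
      have := (hψd (r ^ 2)).hasDerivAt.comp r (hasDerivAt_pow 2 r)
      have h' : HasDerivAt (fun r => ψ (r ^ 2)) _ r := this
      refine h'.congr_deriv ?_
      simp
    have e2 : HasDerivAt (fun r => η r * (r ^ N)⁻¹) 
        (deriv η r * (r ^ N)⁻¹ + η r * (-(N * r ^ (N - 1)) / (r ^ N) ^ 2)) r :=
      ((h1.differentiable (by simp)) r).hasDerivAt.mul ((hasDerivAt_pow N r).inv (by positivity))
    have e3 : (fun r => ψ (r ^ 2)) =ᶠ[𝓝 r] (fun r => η r * (r ^ N)⁻¹) := by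
      filter_upwards [lt_mem_nhds hr] with x hx
      simp [hψ, Real.sqrt_sq hx.le]
    have e4 := e1.unique (e2.congr_of_eventuallyEq e3)
    have e5 : ψ (r ^ 2) = η r * (r ^ N)⁻¹ := e3.eq_of_nhds
    have e6 : r ^ N = r ^ (N - 1) * r := by rw [← pow_succ]; congr 1; omega
    rw [e5, show 2 * r ^ 2 * deriv ψ (r ^ 2) = r * (deriv ψ (r ^ 2) * (2 * r)) by ring, e4, e6]
    field_simp
    ring
  have hφd : ∀ (i : Fin N) (x : Euc N), HasFDerivAt (fun x : Euc N => ψ (‖x‖ ^ 2) * x i)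
      (ψ (‖x‖ ^ 2) • (EuclideanSpace.proj i : Euc N →L[ℝ] ℝ) + 
        x i • (deriv ψ (‖x‖ ^ 2) • (2 • (innerSL ℝ x)))) x := by
    intro i x
    have a1 : HasFDerivAt (fun x : Euc N => ψ (‖x‖ ^ 2)) (deriv ψ (‖x‖ ^ 2) • (2 • (innerSL ℝ x))) x :=
      HasDerivAt.comp_hasFDerivAt (h₂ := ψ) (f := fun x : Euc N => ‖x‖ ^ 2) x (hψd (‖x‖ ^ 2)).hasDerivAt (hasStrictFDerivAt_norm_sq x).hasFDerivAt
    exact a1.mul (EuclideanSpace.proj i : Euc N →L[ℝ] ℝ).hasFDerivAt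
  have hNne : N ≠ 0 := by omega
  refine ⟨fun i x => ψ (‖x‖ ^ 2) * x i, fun i => ?_, fun i => ?_, fun i x => ?_, fun x => ?_⟩
  · exact (hψ1.comp (contDiff_norm_sq ℝ)).mul (EuclideanSpace.proj i : Euc N →L[ℝ] ℝ).contDiff
  · refine HasCompactSupport.intro (isCompact_closedBall (0 : Euc N) R) fun x hx => ?_
    have : η ‖x‖ = 0 := by
      apply image_eq_zero_of_notMem_tsupport
      intro h
      have := hR h
      simp at this hx
      linarith
    simp [hψ, this]
  · simp [hψ]
  · have : ∀ i, fderiv ℝ (fun x : Euc N => ψ (‖x‖ ^ 2) * x i) x (EuclideanSpace.single i 1) =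
        ψ (‖x‖ ^ 2) + 2 * deriv ψ (‖x‖ ^ 2) * x i ^ 2 := by
      intro i
      rw [(hφd i x).fderiv]
      simp [EuclideanSpace.inner_single_right]
      ring
    simp only [this]
    rw [Finset.sum_add_distrib, ← Finset.mul_sum (f := fun i => x i ^ 2), ← EuclideanSpace.real_norm_sq_eq]
    rcases eq_or_ne x 0 with rfl | hx
    · simp [hψ, hz 0 ha0]
    · rw [← hψ' ‖x‖ (norm_pos_iff.2 hx)]
      simp
      ring

/-- spherical mean of the radial derivative -/
def auxF {N : ℕ} (g : Fin N → Euc N → ℝ) (r : ℝ) : ℝ :=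
  ((volume : Measure (Euc N)).toSphere.real Set.univ)⁻¹ *
    ∫ σ : sphere (0 : Euc N) 1, (∑ i, g i (r • (σ : Euc N)) * (σ : Euc N) i)
      ∂((volume : Measure (Euc N)).toSphere)

lemma aux_kappa_pos {N : ℕ} (hN : 1 < N) :
    0 < (volume : Measure (Euc N)).toSphere.real Set.univ := by
  have : Nonempty (Fin N) := ⟨⟨0, by omega⟩⟩
  have : NeZero (volume : Measure (Euc N)).toSphere := ⟨Measure.toSphere_ne_zero _⟩
  exact measureReal_univ_pos

lemma aux_weak {N : ℕ} (hN : 1 < N) (f : ℝ → ℝ) (g : Fin N → Euc N → ℝ)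
    (hw : ∀ i, IsWeakPartialDeriv i (fun x => f ‖x‖) (g i))
    (η : ℝ → ℝ) (h1 : ContDiff ℝ (⊤ : ℕ∞) η)
    (h2 : HasCompactSupport η) (h3 : tsupport η ⊆ Set.Ioi 0) :
    ∫ r in Set.Ioi 0, f r * deriv η r = - ∫ r in Set.Ioi 0, auxF g r * η r := by
  have : Nonempty (Fin N) := ⟨⟨0, by omega⟩⟩
  have hκ := aux_kappa_pos hN
  obtain ⟨φ, φ1, φ2, φ3, φ4⟩ := aux_test hN η h1 h2 h3
  have i1 : ∀ i, Integrable (fun x => g i x * φ i x) := fun i =>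
    (hw i).2.1.integrable_smul_right_of_hasCompactSupport (φ1 i).continuous (φ2 i)
  have i2 : ∀ i, Integrable (fun x : Euc N => f ‖x‖ * fderiv ℝ (φ i) x (EuclideanSpace.single i 1)) := by
    intro i
    refine (hw i).1.integrable_smul_right_of_hasCompactSupport 
      (g := fun x => fderiv ℝ (φ i) x (EuclideanSpace.single i 1)) ?_ ?_
    · exact ((φ1 i).continuous_fderiv (by simp)).clm_apply continuous_const
    · exact (φ2 i).fderiv_apply ℝ _
  have e1 : ∫ x : Euc N, f ‖x‖ * (deriv η ‖x‖ * ‖x‖ * (‖x‖ ^ N)⁻¹) = 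
      - ∫ x : Euc N, ∑ i, g i x * φ i x := by
    have : ∀ x : Euc N, f ‖x‖ * (deriv η ‖x‖ * ‖x‖ * (‖x‖ ^ N)⁻¹) =
        ∑ i, f ‖x‖ * fderiv ℝ (φ i) x (EuclideanSpace.single i 1) := by
      intro x; rw [← φ4, Finset.mul_sum]
    simp only [this]
    rw [integral_finsetSum _ fun i _ => i2 i, integral_finsetSum _ fun i _ => i1 i,
      ← Finset.sum_neg_distrib]
    refine Finset.sum_congr rfl fun i _ => ?_
    have := (hw i).2.2 (φ i) (φ1 i) (φ2 i)
    simpa [pderivList] using this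
  rw [integral_fun_norm_addHaar volume (fun r => f r * (deriv η r * r * (r ^ N)⁻¹)),
    aux_polar_integral hN _ (integrable_finsetSum _ fun i _ => i1 i)] at e1
  have hNe : N = N - 1 + 1 := by omega
  have e2 : ∫ r in Set.Ioi (0:ℝ), r ^ (Module.finrank ℝ (Euc N) - 1) • (f r * (deriv η r * r * (r ^ N)⁻¹)) =
      ∫ r in Set.Ioi (0:ℝ), f r * deriv η r := by
    refine setIntegral_congr_fun measurableSet_Ioi fun r hr => ?_
    have hr : 0 < r := hr
    have e6 : r ^ N = r ^ (N - 1) * r := by rw [← pow_succ]; congr 1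
    simp only [finrank_euclideanSpace, Fintype.card_fin, smul_eq_mul]
    rw [e6]; field_simp
  have e3 : ∫ r in Set.Ioi (0:ℝ), r ^ (N - 1) * (∫ σ : sphere (0 : Euc N) 1, 
      ∑ i, g i (r • (σ : Euc N)) * φ i (r • (σ : Euc N)) ∂((volume : Measure (Euc N)).toSphere)) =
      (volume : Measure (Euc N)).toSphere.real Set.univ * ∫ r in Set.Ioi (0:ℝ), auxF g r * η r := by
    rw [← integral_const_mul]
    refine setIntegral_congr_fun measurableSet_Ioi fun r hr => ?_
    have hr : 0 < r := hr
    have e6 : r ^ N = r ^ (N - 1) * r := by rw [← pow_succ]; congr 1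
    simp only [auxF]
    rw [show ∀ a b c : ℝ, a * (a⁻¹ * b * c) = (a * a⁻¹) * (c * b) from fun a b c => by ring,
      mul_inv_cancel₀ hκ.ne', one_mul, ← integral_const_mul, ← integral_const_mul]
    refine integral_congr_ae (.of_forall fun σ => ?_)
    simp only [Finset.mul_sum]
    refine Finset.sum_congr rfl fun i _ => ?_
    rw [φ3]
    have : ‖r • (σ : Euc N)‖ = r := by simp [norm_smul, abs_of_pos hr]
    rw [this, e6]
    simp only [PiLp.smul_apply, smul_eq_mul]
    field_simp
  rw [e2, e3] at e1
  have e4 : (volume : Measure (Euc N)).toSphere.real Set.univ = 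
    Module.finrank ℝ (Euc N) * (volume : Measure (Euc N)).real (ball 0 1) :=
    Measure.toSphere_real_apply_univ _
  rw [nsmul_eq_mul, smul_eq_mul, ← mul_assoc, ← e4, ← mul_neg] at e1
  exact mul_left_cancel₀ hκ.ne' e1

lemma aux_locint {N : ℕ} (hN : 1 < N) (f : ℝ → ℝ)
    (h : LocallyIntegrable (fun x : Euc N => f ‖x‖)) : LocallyIntegrableOn f (Set.Ioi 0) := by
  have : Nonempty (Fin N) := ⟨⟨0, by omega⟩⟩
  rw [locallyIntegrableOn_iff isOpen_Ioi.isLocallyClosed]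
  intro k hk hkc
  obtain ⟨R, hR⟩ := hkc.isBounded.subset_ball 0
  have h1 : IntegrableOn (fun x : Euc N => f ‖x‖) (ball 0 R) :=
    (h.integrableOn_isCompact (isCompact_closedBall 0 R)).mono_set ball_subset_closedBall
  rw [integrableOn_fun_norm_addHaar] at h1
  have h2 : k ⊆ Set.Ioo 0 R := fun x hx => by
    have := hR hx
    rw [mem_ball_zero_iff, Real.norm_eq_abs, abs_lt] at this
    exact ⟨hk hx, this.2⟩
  have h3 := h1.mono_set h2
  have h4 : IntegrableOn (fun y => (y ^ (Module.finrank ℝ (Euc N) - 1))⁻¹ * (y ^ (Module.finrank ℝ (Euc N) - 1) • f y)) k := by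
    refine h3.continuousOn_mul (ContinuousOn.inv₀ (by fun_prop) ?_) hkc
    intro x hx
    have : 0 < x := hk hx
    positivity
  refine h4.congr_fun (fun x hx => ?_) hkc.measurableSet
  have : 0 < x := hk hx
  simp only [smul_eq_mul]
  field_simp

lemma auxF_meas {N : ℕ} (g : Fin N → Euc N → ℝ) (hg : ∀ i, Measurable (g i)) :
    Measurable (auxF g) := by
  unfold auxF
  apply Measurable.const_mul
  apply StronglyMeasurable.measurable
  apply StronglyMeasurable.integral_prod_left (f := fun (σ : sphere (0 : Euc N) 1) (r : ℝ) => (∑ i, g i (r • (σ : Euc N)) * (σ : Euc N) i))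
  apply Measurable.stronglyMeasurable
  refine Finset.measurable_sum _ fun i _ => ?_
  refine Measurable.mul ((hg i).comp (by fun_prop)) (by fun_prop)

lemma aux_gradNorm_meas {N : ℕ} (g : Fin N → Euc N → ℝ) (hg : ∀ i, Measurable (g i)) :
    Measurable (gradNorm1 g) := by
  unfold gradNorm1
  exact (Finset.measurable_sum _ fun i _ => (hg i).pow_const 2).sqrt

lemma aux_cs {N : ℕ} (g : Fin N → Euc N → ℝ) (x : Euc N) (σ : sphere (0 : Euc N) 1) :
    ‖∑ i, g i x * (σ : Euc N) i‖ₑ ≤ ‖gradNorm1 g x‖ₑ := by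
  rw [Real.enorm_eq_ofReal_abs, Real.enorm_eq_ofReal_abs]
  apply ENNReal.ofReal_le_ofReal
  unfold gradNorm1
  rw [abs_of_nonneg (Real.sqrt_nonneg _)]
  apply Real.abs_le_sqrt
  refine (Finset.sum_mul_sq_le_sq_mul_sq _ _ _).trans ?_
  have : ∑ i, (σ : Euc N) i ^ 2 = 1 := by
    rw [← EuclideanSpace.real_norm_sq_eq]; simp
  rw [this, mul_one]

lemma aux_B {N : ℕ} (hN : 1 < N) (s p : ℝ) (hp : 1 ≤ p) : ∃ K : ℝ≥0∞, K ≠ ⊤ ∧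
    ∀ g : Fin N → Euc N → ℝ, (∀ i, Measurable (g i)) →
    ∫⁻ t in Set.Ioi 0, ‖auxF g t‖ₑ ^ p * ENNReal.ofReal (t ^ ((N:ℝ) - 1) * (1 + t) ^ (-s * p - N)) ≤
      K * (eLpNorm (fun x => wt N s (ENNReal.ofReal p) x * gradNorm1 g x) (ENNReal.ofReal p) volume) ^ p := by
  have : Nonempty (Fin N) := ⟨⟨0, by omega⟩⟩
  have hκ := aux_kappa_pos hN
  set τ := (volume : Measure (Euc N)).toSphere
  have hp0 : 0 < p := by linarith
  refine ⟨(‖(τ.real Set.univ)⁻¹‖ₑ) ^ p * (τ Set.univ) ^ (p - 1), ?_, fun g hg => ?_⟩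
  · apply ENNReal.mul_ne_top
    · exact ENNReal.rpow_ne_top_of_nonneg hp0.le enorm_ne_top
    · exact ENNReal.rpow_ne_top_of_nonneg (by linarith) (measure_ne_top _ _)
  have hgm := aux_gradNorm_meas g hg
  have hwm : Measurable (fun x => wt N s (ENNReal.ofReal p) x) := by
    unfold wt; fun_prop
  rw [eLpNorm_eq_lintegral_rpow_enorm_toReal (by simpa using hp0) (by simp),
    ← ENNReal.rpow_mul, ENNReal.toReal_ofReal hp0.le, one_div, inv_mul_cancel₀ hp0.ne', ENNReal.rpow_one,
    aux_polar_lintegral hN _ (by fun_prop), ← lintegral_const_mul']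
  rotate_left
  · apply ENNReal.mul_ne_top
    · exact ENNReal.rpow_ne_top_of_nonneg hp0.le enorm_ne_top
    · exact ENNReal.rpow_ne_top_of_nonneg (by linarith) (measure_ne_top _ _)
  refine setLIntegral_mono' measurableSet_Ioi fun r hr => ?_
  have hr : 0 < r := hr
  have hF : ‖auxF g r‖ₑ ≤ ‖(τ.real Set.univ)⁻¹‖ₑ * ∫⁻ σ, ‖gradNorm1 g (r • (σ : Euc N))‖ₑ ∂τ := by
    unfold auxF
    rw [enorm_mul]
    refine mul_le_mul_right ?_ _
    refine (enorm_integral_le_lintegral_enorm _).trans ?_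
    exact lintegral_mono fun σ => aux_cs g _ σ
  have hJ := aux_jensen τ p hp (fun σ => ‖gradNorm1 g (r • (σ : Euc N))‖ₑ) (fun _ => 1)
    ((hgm.comp (by fun_prop)).enorm) measurable_const (.of_forall fun _ => by simp)
  simp only [lintegral_const, one_mul, ENNReal.one_rpow, mul_one] at hJ
  have hw : ∀ σ : sphere (0 : Euc N) 1, ‖wt N s (ENNReal.ofReal p) (r • (σ : Euc N)) * gradNorm1 g (r • (σ : Euc N))‖ₑ ^ p
      = ENNReal.ofReal ((1 + r) ^ (-s * p - N)) * ‖gradNorm1 g (r • (σ : Euc N))‖ₑ ^ p := by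
    intro σ
    rw [enorm_mul, ENNReal.mul_rpow_of_nonneg _ _ hp0.le]
    congr 1
    unfold wt
    have : ‖r • (σ : Euc N)‖ = r := by simp [norm_smul, abs_of_pos hr]
    rw [this, ENNReal.toReal_ofReal hp0.le, Real.enorm_eq_ofReal (by positivity),
      ENNReal.ofReal_rpow_of_nonneg (by positivity) hp0.le, ← Real.rpow_mul (by positivity)]
    congr 2
    field_simp
  simp only [hw]
  rw [lintegral_const_mul' _ _ ENNReal.ofReal_ne_top, ENNReal.ofReal_mul (by positivity)]
  have hpow : r ^ ((N:ℝ) - 1) = r ^ (N - 1) := by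
    rw [← Real.rpow_natCast]; congr 1
    rw [Nat.cast_sub (by omega)]; simp
  rw [hpow]
  calc _ ≤ ((‖(τ.real Set.univ)⁻¹‖ₑ) ^ p * ((τ Set.univ) ^ (p - 1) * ∫⁻ σ, ‖gradNorm1 g (r • (σ : Euc N))‖ₑ ^ p ∂τ)) * 
        (ENNReal.ofReal (r ^ (N - 1)) * ENNReal.ofReal ((1 + r) ^ (-s * p - N))) := by
        refine mul_le_mul_left ?_ _
        refine (ENNReal.rpow_le_rpow hF hp0.le).trans ?_
        rw [ENNReal.mul_rpow_of_nonneg _ _ hp0.le]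
        exact mul_le_mul_right hJ _
    _ = _ := by ring

lemma aux_Ijp {N : ℕ} (hN : 1 < N) (p : ℝ) (hp : 1 ≤ p) (q : ℝ≥0∞) (hq : q ∈ Ijp N 1 p) :
    ENNReal.ofReal p ≤ q ∧ (q = ⊤ → (N:ℝ) < p) ∧ (q ≠ ⊤ → 0 ≤ N * p / q.toReal + p - N) := by
  have hN0 : (0:ℝ) < N := by exact_mod_cast (by omega : 0 < N)
  unfold Ijp at hq
  simp only [Nat.cast_one, div_one] at hq
  have h0 : 0 ≤ N * p / q.toReal := by positivity
  split_ifs at hq with h1 h2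
  · refine ⟨hq.1, fun h => absurd h hq.2.ne, fun _ => ?_⟩
    linarith [h1.1]
  · have hqt : q ≠ ⊤ := ne_top_of_le_ne_top ENNReal.ofReal_ne_top hq.2
    refine ⟨hq.1, fun h => absurd h hqt, fun _ => ?_⟩
    have hq0 : 0 < q.toReal := by
      apply ENNReal.toReal_pos _ hqt
      intro h
      have := hq.1
      rw [h] at this
      simp at this
      linarith
    have hd : (0:ℝ) < N - 1 * p := by linarith
    have h3 : q.toReal ≤ N * p / (N - 1 * p) := by
      apply ENNReal.toReal_le_of_le_ofReal (by positivity) hq.2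
    rw [le_div_iff₀ hd] at h3
    have : (N:ℝ) - p ≤ N * p / q.toReal := by
      rw [le_div_iff₀ hq0]; linarith
    linarith
  · have : (N:ℝ) < p := by
      rcases lt_trichotomy p N with h | h | h
      · exact absurd h h2
      · exact absurd ⟨h, hN⟩ h1
      · exact h
    exact ⟨hq.1, fun _ => this, fun _ => by linarith⟩

lemma aux_emb {N : ℕ} (hN : 1 < N) (s p : ℝ) (hs : s < -1) (hp : 1 ≤ p) (q : ℝ≥0∞)
    (hq : q ∈ Ijp N 1 p) : ∃ D : ℝ≥0∞, D ≠ ⊤ ∧ ∀ G : ℝ → ℝ≥0∞, Measurable G →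
    ∀ w : Euc N → ℝ, (∀ᵐ x, ‖w x‖ₑ ≤ ∫⁻ t in Set.Ioi ‖x‖, G t) →
    eLpNorm (fun x => wt N (s + 1) q x * w x) q volume ≤ D *
      (∫⁻ t in Set.Ioi 0, G t ^ p * ENNReal.ofReal (t ^ ((N:ℝ) - 1) * (1 + t) ^ (-s * p - N))) ^ (1 / p) := by
  have : Nonempty (Fin N) := ⟨⟨0, by omega⟩⟩
  obtain ⟨hq1, hq2, hq3⟩ := aux_Ijp hN p hp q hq
  have hp0 : 0 < p := by linarith
  have hN0 : (0:ℝ) < N := by exact_mod_cast (by omega : 0 < N)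
  have hN1 : (1:ℝ) ≤ N := by exact_mod_cast (by omega : 1 ≤ N)
  by_cases hqt : q = ⊤
  · subst hqt
    obtain ⟨C, hC, hCG⟩ := aux_point_sup (N:ℝ) p s hN1 (hq2 rfl) hs
    refine ⟨C ^ (1 / p), ENNReal.rpow_ne_top_of_nonneg (by positivity) hC, fun G hG w hw => ?_⟩
    rw [← ENNReal.mul_rpow_of_nonneg _ _ (by positivity), eLpNorm_exponent_top]
    have h0 : ∀ᵐ x : Euc N, 0 < ‖x‖ := aux_ae_norm hN (fun r => 0 < r) (ae_restrict_mem measurableSet_Ioi)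
    apply eLpNormEssSup_le_of_ae_enorm_bound
    filter_upwards [hw, h0] with x hx hx0
    rw [one_div, ENNReal.le_rpow_inv_iff hp0, enorm_mul, ENNReal.mul_rpow_of_nonneg _ _ hp0.le]
    have hwt : ‖wt N (s + 1) ⊤ x‖ₑ ^ p = ENNReal.ofReal ((1 + ‖x‖) ^ (-(s+1) * p)) := by
      unfold wt
      rw [Real.enorm_eq_ofReal (by positivity),
        ENNReal.ofReal_rpow_of_nonneg (by positivity) hp0.le, ← Real.rpow_mul (by positivity)]
      simp
    rw [hwt, mul_comm]
    refine (mul_le_mul_left (ENNReal.rpow_le_rpow hx hp0.le) _).trans ((hCG G hG ‖x‖ hx0).trans ?_)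
    refine mul_le_mul_right ?_ _
    exact lintegral_mono_set (Set.Ioi_subset_Ioi hx0.le)
  · have hq0 : p ≤ q.toReal := (ENNReal.ofReal_le_iff_le_toReal hqt).1 hq1
    have hq00 : 0 < q.toReal := by linarith
    obtain ⟨C, hC, hCG⟩ := aux_hardy (N:ℝ) p q.toReal s hN0 hp hq0 hs (hq3 hqt)
    set τ := (volume : Measure (Euc N)).toSphere
    refine ⟨(τ Set.univ * C) ^ (1 / q.toReal), ENNReal.rpow_ne_top_of_nonneg (by positivity) 
      (ENNReal.mul_ne_top (measure_ne_top _ _) hC), fun G hG w hw => ?_⟩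
    have hpq : (1 / p) = (q.toReal / p) * (1 / q.toReal) := by field_simp
    rw [hpq, ENNReal.rpow_mul, ← ENNReal.mul_rpow_of_nonneg _ _ (by positivity),
      eLpNorm_eq_lintegral_rpow_enorm_toReal (by rintro rfl; simp at hq00) hqt]
    refine ENNReal.rpow_le_rpow ?_ (by positivity)
    have hwt : ∀ x : Euc N, ‖wt N (s + 1) q x‖ₑ ^ q.toReal = ENNReal.ofReal ((1 + ‖x‖) ^ (-(s+1) * q.toReal - N)) := by
      intro x
      unfold wt
      rw [Real.enorm_eq_ofReal (by positivity),
        ENNReal.ofReal_rpow_of_nonneg (by positivity) hq00.le, ← Real.rpow_mul (by positivity)]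
      congr 2
      field_simp
    have hmt := aux_tail_meas G
    calc _ ≤ ∫⁻ x : Euc N, (∫⁻ t in Set.Ioi ‖x‖, G t) ^ q.toReal * ENNReal.ofReal ((1 + ‖x‖) ^ (-(s+1) * q.toReal - N)) := by
          apply lintegral_mono_ae
          filter_upwards [hw] with x hx
          rw [enorm_mul, ENNReal.mul_rpow_of_nonneg _ _ hq00.le, hwt, mul_comm]
          exact mul_le_mul_left (ENNReal.rpow_le_rpow hx hq00.le) _
      _ = τ Set.univ * ∫⁻ r in Set.Ioi 0, (∫⁻ t in Set.Ioi r, G t) ^ q.toReal * 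
            ENNReal.ofReal (r ^ ((N:ℝ) - 1) * (1 + r) ^ (-(s+1) * q.toReal - N)) := by
          rw [aux_polar_lintegral hN, ← lintegral_const_mul' _ _ (measure_ne_top _ _)]
          · refine setLIntegral_congr_fun measurableSet_Ioi fun r hr => ?_
            have hr : 0 < r := hr
            have hpow : r ^ ((N:ℝ) - 1) = r ^ (N - 1) := by
              rw [← Real.rpow_natCast]; congr 1
              rw [Nat.cast_sub (by omega)]; simp
            have : ∀ σ : sphere (0 : Euc N) 1, ‖r • (σ : Euc N)‖ = r := fun σ => by simp [norm_smul, abs_of_pos hr]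
            simp only [this, lintegral_const]
            rw [ENNReal.ofReal_mul (by positivity), hpow]
            ring
          · exact ((hmt.comp measurable_norm).pow_const _).mul (by fun_prop)
      _ ≤ _ := by
          rw [mul_assoc]
          exact mul_le_mul_right (hCG G hG) _

lemma aux_unique {N : ℕ} (hN : 1 < N) (s d : ℝ) (hs : s < -1) (q : ℝ≥0∞) (hq : 1 ≤ q)
    (h : MemLp (fun x => wt N (s + 1) q x * d) q volume) : d = 0 := by
  have : Nonempty (Fin N) := ⟨⟨0, by omega⟩⟩
  by_contra hd
  have h1 : MemLp (fun x => wt N (s + 1) q x) q volume := by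
    have := h.mul_const d⁻¹
    refine this.ae_eq (.of_forall fun x => ?_)
    simp only
    field_simp
  by_cases hqt : q = ⊤
  · subst hqt
    obtain ⟨M, hM⟩ : ∃ M : ℝ, ∀ᵐ x : Euc N, ‖wt N (s + 1) ⊤ x‖ ≤ M := by
      have := h1.2
      rw [eLpNorm_exponent_top] at this
      refine ⟨(eLpNormEssSup (fun x => wt N (s + 1) ⊤ x) volume).toReal, ?_⟩
      filter_upwards [enorm_ae_le_eLpNormEssSup (fun x => wt N (s + 1) ⊤ x) volume] with x hx
      have := ENNReal.toReal_mono this.ne hx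
      simpa using this
    have ht : Tendsto (fun x : Euc N => wt N (s + 1) ⊤ x) (cocompact _) atTop := by
      unfold wt
      have : Tendsto (fun x : Euc N => 1 + ‖x‖) (cocompact _) atTop :=
        tendsto_atTop_add_const_left _ _ (tendsto_norm_cocompact_atTop)
      exact (tendsto_rpow_atTop (by simp; linarith)).comp this
    have h2 : ∀ x : Euc N, wt N (s + 1) ⊤ x ≤ M := by
      have hc : Continuous (fun x : Euc N => wt N (s + 1) ⊤ x) := by
        unfold wt
        refine Continuous.rpow_const (by fun_prop) fun x => Or.inl ?_
        positivity
      have ho : IsOpen {x : Euc N | M < wt N (s + 1) ⊤ x} := isOpen_lt continuous_const hc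
      have : volume {x : Euc N | M < wt N (s + 1) ⊤ x} = 0 := by
        refine measure_mono_null (fun x hx => ?_) (ae_iff.1 hM)
        simp only [Set.mem_ofPred_eq, not_le] at hx ⊢
        exact hx.trans_le (le_abs_self _)
      have h3 := (ho.measure_eq_zero_iff volume).1 this
      intro x
      by_contra hx
      have : x ∈ ({x : Euc N | M < wt N (s + 1) ⊤ x}) := not_le.1 hx
      rw [h3] at this
      exact this
    obtain ⟨x, hx⟩ := (ht.eventually_gt_atTop M).exists
    exact absurd (h2 x) (not_le.2 hx)
  · have hq0 : 0 < q.toReal := ENNReal.toReal_pos (by rintro rfl; simp at hq) hqt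
    have h2 := h1.integrable_norm_rpow (by rintro rfl; simp at hq) hqt
    have h3 : Integrable (fun x : Euc N => (fun r : ℝ => (1 + r) ^ (-(s+1) * q.toReal - N)) ‖x‖) := by
      refine h2.congr (.of_forall fun x => ?_)
      unfold wt
      simp only
      rw [Real.norm_of_nonneg (by positivity), ← Real.rpow_mul (by positivity)]
      congr 1
      field_simp
    replace h3 := (integrable_fun_norm_addHaar volume (f := fun r : ℝ => (1 + r) ^ (-(s+1) * q.toReal - N))).1 h3
    have h4 := (h3.mono_set (Set.Ioi_subset_Ioi zero_le_one)).const_mul ((2:ℝ) ^ (N:ℝ))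
    apply not_integrableOn_Ioi_inv (a := (1:ℝ))
    refine h4.mono' (by fun_prop) ?_
    filter_upwards [ae_restrict_mem measurableSet_Ioi] with r hr
    have hr : 1 < r := hr
    have hr0 : 0 < r := by linarith
    rw [Real.norm_of_nonneg (by positivity)]
    simp only [finrank_euclideanSpace, Fintype.card_fin, smul_eq_mul]
    have e1 : (1 + r) ^ (-(N:ℝ)) ≤ (1 + r) ^ (-(s+1) * q.toReal - N) := by
      apply Real.rpow_le_rpow_of_exponent_le (by linarith)
      nlinarith
    have e2 : (2 * r) ^ (-(N:ℝ)) ≤ (1 + r) ^ (-(N:ℝ)) := 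
      Real.rpow_le_rpow_of_nonpos (by positivity) (by linarith) (by simp)
    have e3 : r⁻¹ = 2 ^ (N:ℝ) * (r ^ (N - 1) * (2 * r) ^ (-(N:ℝ))) := by
      have e6 : r ^ N = r ^ (N - 1) * r := by rw [← pow_succ]; congr 1; omega
      rw [Real.rpow_neg (by positivity), Real.rpow_natCast, Real.rpow_natCast, mul_pow, e6]
      field_simp
    rw [e3]
    gcongr
    exact e2.trans e1

lemma aux_tail_tendsto (k : ℝ → ℝ≥0∞) (hk : Measurable k) (hf : ∫⁻ t in Set.Ioi 0, k t ≠ ⊤) :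
    Tendsto (fun r => ∫⁻ t in Set.Ioi r, k t) atTop (𝓝 0) := by
  have h1 : Tendsto (fun r : ℝ => ∫⁻ t in Set.Ioi 0, (Set.Ioi r).indicator k t) atTop
      (𝓝 (∫⁻ t in Set.Ioi (0:ℝ), 0)) := by
    refine tendsto_lintegral_filter_of_dominated_convergence k 
      (.of_forall fun r => hk.indicator measurableSet_Ioi) (.of_forall fun r => .of_forall fun t => ?_) hf
      (.of_forall fun t => ?_)
    · exact Set.indicator_le_self _ _ _
    · refine tendsto_const_nhds.congr' ?_
      filter_upwards [eventually_ge_atTop t] with r hr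
      simp [hr]
  rw [lintegral_zero] at h1
  refine h1.congr' ?_
  filter_upwards [eventually_ge_atTop 0] with r hr
  rw [lintegral_indicator measurableSet_Ioi, Measure.restrict_restrict measurableSet_Ioi,
    Set.inter_eq_left.2 (Set.Ioi_subset_Ioi hr)]

lemma aux_limit {N : ℕ} (hN : 1 < N) (s p : ℝ) (hs : s < -1) (hp : (N:ℝ) < p) (F : ℝ → ℝ)
    (hF : Measurable F) 
    (hB : ∫⁻ t in Set.Ioi 0, ‖F t‖ₑ ^ p * ENNReal.ofReal (t ^ ((N:ℝ) - 1) * (1 + t) ^ (-s * p - N)) ≠ ⊤) :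
    Tendsto (fun x : Euc N => ‖x‖ ^ (-(s + 1)) * (-∫ t in Set.Ioi ‖x‖, F t))
      (cocompact (Euc N)) (nhds 0) := by
  have : Nonempty (Fin N) := ⟨⟨0, by omega⟩⟩
  have hN1 : (1:ℝ) ≤ N := by exact_mod_cast (by omega : 1 ≤ N)
  have hp0 : 0 < p := by linarith
  obtain ⟨C, hC, hCG⟩ := aux_point_sup (N:ℝ) p s hN1 hp hs
  have hT := aux_tail_tendsto _ (by fun_prop) hB
  have hT2 : Tendsto (fun r => (C * ∫⁻ t in Set.Ioi r, ‖F t‖ₑ ^ p * ENNReal.ofReal (t ^ ((N:ℝ) - 1) * (1 + t) ^ (-s * p - N))) ^ (1 / p)) atTop (𝓝 0) := by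
    have h1 := ENNReal.Tendsto.const_mul (a := C) hT (Or.inr hC)
    have h2 := (ENNReal.continuous_rpow_const (y := 1 / p)).tendsto (C * 0) |>.comp h1
    simp only [mul_zero] at h2
    rw [ENNReal.zero_rpow_of_pos (by positivity)] at h2
    exact h2
  have hT3 := hT2.comp (tendsto_norm_cocompact_atTop (E := Euc N))
  rw [tendsto_zero_iff_enorm_tendsto_zero]
  refine tendsto_of_tendsto_of_tendsto_of_le_of_le' tendsto_const_nhds hT3 (.of_forall fun _ => zero_le) ?_
  have hpos : ∀ᶠ x : Euc N in cocompact _, 0 < ‖x‖ := tendsto_norm_cocompact_atTop.eventually_gt_atTop 0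
  filter_upwards [hpos] with x hx
  simp only [Function.comp]
  rw [one_div, ENNReal.le_rpow_inv_iff hp0]
  refine le_trans ?_ (hCG (fun t => ‖F t‖ₑ) (by fun_prop) ‖x‖ hx)
  rw [enorm_mul, ENNReal.mul_rpow_of_nonneg _ _ hp0.le, enorm_neg, mul_comm]
  refine mul_le_mul' (ENNReal.rpow_le_rpow (enorm_integral_le_lintegral_enorm _) hp0.le) ?_
  rw [Real.enorm_eq_ofReal (by positivity),
        ENNReal.ofReal_rpow_of_nonneg (by positivity) hp0.le, Real.rpow_mul (by positivity)]
  apply ENNReal.ofReal_le_ofReal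
  refine Real.rpow_le_rpow (by positivity) (Real.rpow_le_rpow (by positivity) (by linarith) (by linarith)) hp0.le

lemma aux_grad_finite {N : ℕ} (s p : ℝ) (g : Fin N → Euc N → ℝ)
    (hg : ∀ i, MemLs N s (ENNReal.ofReal p) (g i)) :
    eLpNorm (fun x => wt N s (ENNReal.ofReal p) x * gradNorm1 g x) (ENNReal.ofReal p) volume ≠ ⊤ := by
  have h1 : MemLp (fun x => ∑ i, ‖wt N s (ENNReal.ofReal p) x * g i x‖) (ENNReal.ofReal p) volume :=
    memLp_finsetSum _ fun i _ => (hg i).norm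
  refine (lt_of_le_of_lt (eLpNorm_mono fun x => ?_) h1.2).ne
  have h0 : 0 ≤ wt N s (ENNReal.ofReal p) x := by unfold wt; positivity
  rw [Real.norm_of_nonneg (Finset.sum_nonneg fun i _ => norm_nonneg _), norm_mul, 
    Real.norm_of_nonneg h0]
  simp only [norm_mul, Real.norm_of_nonneg h0]
  rw [← Finset.mul_sum]
  refine mul_le_mul_of_nonneg_left ?_ h0
  unfold gradNorm1
  rw [Real.norm_of_nonneg (Real.sqrt_nonneg _)]
  apply Real.sqrt_le_iff.2 
  refine ⟨Finset.sum_nonneg fun i _ => norm_nonneg _, ?_⟩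
  have := Finset.sum_sq_le_sq_sum_of_nonneg (s := Finset.univ) (f := fun i => ‖g i x‖) (fun i _ => norm_nonneg _)
  simpa using this

lemma wt_meas (N : ℕ) (s : ℝ) (q : ℝ≥0∞) : Measurable (fun x => wt N s q x) := by
  unfold wt; fun_prop


/-- Theorem 5(ii). If `N > 1`, `s < -1`, `1 ≤ p < ∞` and `u` is
radially symmetric with `∇u ∈ (L^p_s)^N`, there is a constant `c_u` (independent of `q`
and unique) such that `u - c_u ∈ L^q_{s+1}` for every `q ∈ I_{1,p}`, with
`‖u - c_u‖_{L^q_{s+1}} ≤ C(s,p,q) ‖|∇u|‖_{L^p_s}`, and if `p > N` then (a representative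
of) `u` satisfies `|x|^{-(s+1)}(u(x) - c_u) → 0` as `|x| → ∞`. -/
theorem stmt_8 {N : ℕ} (hN : 1 < N) (s p : ℝ) (hs : s < -1) (hp : 1 ≤ p) :
    ∃ C : ℝ≥0∞ → ℝ, (∀ q ∈ Ijp N 1 p, 0 < C q) ∧
      ∀ (u : Euc N → ℝ) (g : Fin N → Euc N → ℝ),
        RadSymm u →
        (∀ i, IsWeakPartialDeriv i u (g i)) →
        (∀ i, MemLs N s (ENNReal.ofReal p) (g i)) →
        ∃ c : ℝ,
          (∀ q ∈ Ijp N 1 p,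
            MemLs N (s + 1) q (fun x => u x - c) ∧
              LsNorm N (s + 1) q (fun x => u x - c)
                ≤ C q * LsNorm N s (ENNReal.ofReal p) (gradNorm1 g)) ∧
          (∀ (c' : ℝ) (q : ℝ≥0∞), q ∈ Ijp N 1 p →
            MemLs N (s + 1) q (fun x => u x - c') → c' = c) ∧
          ((N : ℝ) < p →
            ∃ v : Euc N → ℝ, v =ᵐ[volume] u ∧
              Tendsto (fun x : Euc N => ‖x‖ ^ (-(s + 1)) * (v x - c))
                (cocompact (Euc N)) (nhds 0)) := by
  have hp0 : 0 < p := by linarith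
  have hN0 : (0:ℝ) < N := by exact_mod_cast (by omega : 0 < N)
  choose! D hD hDG using fun q (hq : q ∈ Ijp N 1 p) => aux_emb hN s p hs hp q hq
  obtain ⟨K, hK, hKB⟩ := aux_B hN s p hp
  have hK' : K ^ (1 / p) ≠ ⊤ := ENNReal.rpow_ne_top_of_nonneg (by positivity) hK
  refine ⟨fun q => (D q * K ^ (1 / p)).toReal + 1, fun q _ => by positivity, ?_⟩
  intro u g hu hw hg
  -- measurable representatives of the derivatives
  have hgm : ∀ i, AEStronglyMeasurable (g i) volume := fun i => (hw i).2.1.aestronglyMeasurable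
  set g' : Fin N → Euc N → ℝ := fun i => (hgm i).mk (g i)
  have hg'm : ∀ i, Measurable (g' i) := fun i => (hgm i).stronglyMeasurable_mk.measurable
  have hgg : ∀ i, g i =ᵐ[volume] g' i := fun i => (hgm i).ae_eq_mk
  have hgrad : gradNorm1 g' =ᵐ[volume] gradNorm1 g := by
    filter_upwards [ae_all_iff.2 hgg] with x hx
    simp [gradNorm1, hx]
  set A := eLpNorm (fun x => wt N s (ENNReal.ofReal p) x * gradNorm1 g x) (ENNReal.ofReal p) volume with hA
  have hAt : A ≠ ⊤ := aux_grad_finite s p g hg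
  have hA' : eLpNorm (fun x => wt N s (ENNReal.ofReal p) x * gradNorm1 g' x) (ENNReal.ofReal p) volume = A := by
    apply eLpNorm_congr_ae
    filter_upwards [hgrad] with x hx
    rw [hx]
  -- radial profile
  set e : Euc N := EuclideanSpace.single ⟨0, by omega⟩ 1 with he
  have hen : ‖e‖ = 1 := by simp [he]
  set f : ℝ → ℝ := fun r => u (r • e) with hf
  have huf : u = fun x => f ‖x‖ := by
    funext x
    apply hu
    rw [norm_smul, hen]; simp
  have hul : LocallyIntegrable u volume := (hw ⟨0, by omega⟩).1
  have hw' : ∀ i, IsWeakPartialDeriv i (fun x => f ‖x‖) (g' i) := by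
    intro i
    rw [← huf]
    refine ⟨hul, (hw i).2.1.congr (hgg i), fun φ h1 h2 => ?_⟩
    rw [(hw i).2.2 φ h1 h2]
    congr 1
    apply integral_congr_ae
    filter_upwards [hgg i] with x hx
    rw [hx]
  set F := auxF g' with hFdef
  have hFm : Measurable F := auxF_meas g' hg'm
  have hB := hKB g' hg'm
  rw [hA'] at hB
  have hBt : ∫⁻ t in Set.Ioi 0, ‖F t‖ₑ ^ p * ENNReal.ofReal (t ^ ((N:ℝ) - 1) * (1 + t) ^ (-s * p - N)) ≠ ⊤ :=
    ne_top_of_le_ne_top (ENNReal.mul_ne_top hK (ENNReal.rpow_ne_top_of_nonneg hp0.le hAt)) hB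
  have hFi : ∀ r, 0 < r → IntegrableOn F (Set.Ioi r) := by
    intro r hr
    refine ⟨hFm.aestronglyMeasurable, ?_⟩
    have := aux_tail_finite (N:ℝ) p s hN0 hp hs r hr (fun t => ‖F t‖ₑ) hFm.enorm hBt
    exact this.lt_top
  obtain ⟨c, hc⟩ := aux_repr f F (aux_locint hN f (huf ▸ hul)) hFi
    (fun η h1 h2 h3 => aux_weak hN f g' hw' η h1 h2 h3)
  have hc' : ∀ᵐ x : Euc N, f ‖x‖ - c = -∫ t in Set.Ioi ‖x‖, F t := 
    aux_ae_norm hN (fun r => f r - c = -∫ t in Set.Ioi r, F t) hc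
  have huc : ∀ᵐ x : Euc N, u x - c = -∫ t in Set.Ioi ‖x‖, F t := by
    filter_upwards [hc'] with x hx
    rw [← hx, huf]
  have hbound : ∀ᵐ x : Euc N, ‖u x - c‖ₑ ≤ ∫⁻ t in Set.Ioi ‖x‖, ‖F t‖ₑ := by
    filter_upwards [huc] with x hx
    rw [hx, enorm_neg]
    exact enorm_integral_le_lintegral_enorm _
  have hmain : ∀ q ∈ Ijp N 1 p, eLpNorm (fun x => wt N (s + 1) q x * (u x - c)) q volume ≤
      D q * K ^ (1 / p) * A := by
    intro q hq
    refine (hDG q hq (fun t => ‖F t‖ₑ) hFm.enorm (fun x => u x - c) hbound).trans ?_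
    rw [mul_assoc]
    refine mul_le_mul_right ?_ _
    refine (ENNReal.rpow_le_rpow hB (by positivity)).trans ?_
    rw [ENNReal.mul_rpow_of_nonneg _ _ (by positivity), ← ENNReal.rpow_mul, mul_one_div_cancel hp0.ne',
      ENNReal.rpow_one]
  have hmem : ∀ q ∈ Ijp N 1 p, MemLs N (s + 1) q (fun x => u x - c) := by
    intro q hq
    refine ⟨(wt_meas N (s + 1) q).aestronglyMeasurable.mul 
      (hul.aestronglyMeasurable.sub aestronglyMeasurable_const), ?_⟩
    refine (hmain q hq).trans_lt ?_
    exact (ENNReal.mul_ne_top (ENNReal.mul_ne_top (hD q hq) hK') hAt).lt_top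
  refine ⟨c, fun q hq => ⟨hmem q hq, ?_⟩, fun c' q hq hc' => ?_, fun hpN => ?_⟩
  · unfold LsNorm
    have h1 := ENNReal.toReal_mono 
      (ENNReal.mul_ne_top (ENNReal.mul_ne_top (hD q hq) hK') hAt) (hmain q hq)
    refine h1.trans ?_
    rw [ENNReal.toReal_mul]
    exact mul_le_mul_of_nonneg_right (by linarith) ENNReal.toReal_nonneg
  · have h1 : MemLp (fun x => wt N (s + 1) q x * (c' - c)) q volume := by
      refine ((hmem q hq).sub hc').ae_eq (.of_forall fun x => ?_)
      simp only [Pi.sub_apply]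
      ring
    have hq1 : 1 ≤ q := by
      refine le_trans ?_ (aux_Ijp hN p hp q hq).1
      simpa using hp
    linarith [aux_unique hN s (c' - c) hs q hq1 h1]
  · refine ⟨fun x => c + -∫ t in Set.Ioi ‖x‖, F t, ?_, ?_⟩
    · filter_upwards [huc] with x hx
      rw [← hx]; ring
    · simpa using aux_limit hN s p hs hpN F hFm hBt

end
end
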